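/- Let R be an rc-graph satisfying condition (*) and let Y₁, Y₂ be semistandard Young tableaux with entries in {1,…,n}. Let Y be the unique semistandard Young tableau whose reading word v(Y) is Knuth equivalent to the concatenation v(Y₁)v(Y₂) (this tableau is the Schensted insertion Y₁ ← Y₂). Then (R ← Y₁) ← Y₂ = R ← Y. -/

import Mathlib

open scoped Classical

noncomputable section

namespace RCGraphs

/-- The simple transposition `s j`, interchanging `j` and `j+1`. -/
def sT (j : ℤ) : Equiv.Perm ℤ := Equiv.swap j (j + 1)

/-- The Coxeter length of a permutation of `ℤ`: the minimal length of an expression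
as a product of simple transpositions. -/
def len (w : Equiv.Perm ℤ) : ℕ :=
  sInf {m : ℕ | ∃ l : List ℤ, l.length = m ∧ (l.map sT).prod = w}

/-- The permutations considered in the paper: bijections of `ℤ` fixing every `i > n`
and fixing all sufficiently small integers. -/
def IsPermZ (n : ℤ) (w : Equiv.Perm ℤ) : Prop :=
  (∀ i : ℤ, n < i → w i = i) ∧ ∃ N : ℤ, ∀ i : ℤ, i < N → w i = i

/-- The reading order on positions `(i,k)`: rows (second coordinate) from `n` downward,
and within a row in order of increasing first coordinate. -/
def rcOrder (p q : ℤ × ℤ) : Prop :=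
  q.2 < p.2 ∨ (p.2 = q.2 ∧ p.1 ≤ q.1)

instance : DecidableRel rcOrder := fun p q => by
  unfold rcOrder; infer_instance

instance : IsTrans (ℤ × ℤ) rcOrder :=
  ⟨fun a b c h₁ h₂ => by unfold rcOrder at *; omega⟩

instance : IsAntisymm (ℤ × ℤ) rcOrder :=
  ⟨fun a b h₁ h₂ => by
    unfold rcOrder at *
    have h3 : a.1 = b.1 ∧ a.2 = b.2 := by omega
    exact Prod.ext h3.1 h3.2⟩

instance : IsTotal (ℤ × ℤ) rcOrder :=
  ⟨fun a b => by unfold rcOrder; omega⟩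

/-- The permutation `w_R` associated to a finite set of positions `R`: the product of the
simple transpositions `s_{i+k-n-1}`, `(i,k) ∈ R`, in the reading order. -/
def wR (n : ℤ) (R : Finset (ℤ × ℤ)) : Equiv.Perm ℤ :=
  ((R.sort rcOrder).map fun p => sT (p.1 + p.2 - n - 1)).prod

/-- `R` is an rc-graph: positions lie in the grid `{(i,k) : i ≤ n, k ≤ n}` and the
reading word is reduced. -/
def IsRC (n : ℤ) (R : Finset (ℤ × ℤ)) : Prop :=
  (∀ p ∈ R, p.1 ≤ n ∧ p.2 ≤ n) ∧ len (wR n R) = R.card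

/-- Condition (*): `w_R(i) > w_R(i-1)` for all `i ≤ 0`; equivalently no two strands with
nonpositive labels cross. -/
def Star (n : ℤ) (R : Finset (ℤ × ℤ)) : Prop :=
  ∀ i : ℤ, i ≤ 0 → wR n R (i - 1) < wR n R i

/-- Strand labels in the wiring diagram of `R` (for diagrams all of whose crossings lie in
rows `k ≥ 1`, as is the case under condition (*)).  `lab n R true i k` is the label of the
strand entering position `(i,k)` from the west (the strand passing above, if `(i,k)` is not
a crossing); `lab n R false i k` is the label of the strand entering from the south (the
strand passing below).  Each strand is labeled by the row where it begins. -/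
def lab (n : ℤ) (R : Finset (ℤ × ℤ)) : Bool → ℤ → ℤ → ℤ
  | true, i, k =>
      if h : n ≤ i then k
      else if (i + 1, k) ∈ R then lab n R true (i + 1) k else lab n R false (i + 1) k
  | false, i, k =>
      if h : k ≤ 0 then i + k - n - 1
      else if (i, k - 1) ∈ R then lab n R false i (k - 1) else lab n R true i (k - 1)
  termination_by b i k => ((n - i).toNat + k.toNat)
  decreasing_by
    all_goals simp_wf
    all_goals omega

/-- The label of the strand leaving position `(i,r)` northward. -/
def northLabel (n : ℤ) (R : Finset (ℤ × ℤ)) (i r : ℤ) : ℤ :=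
  if (i, r) ∈ R then lab n R false i r else lab n R true i r

/-- `(i,k)` is an open space: not a crossing, the strand passing below it has a
nonpositive label and the strand passing above it has a positive label. -/
def OpenSpace (n : ℤ) (R : Finset (ℤ × ℤ)) (i k : ℤ) : Prop :=
  i ≤ n ∧ (i, k) ∉ R ∧ lab n R false i k ≤ 0 ∧ 0 < lab n R true i k

/-- The main loop of the Bergeron--Billey insertion algorithm, recording the trace:
the list of pairs (current diagram, crossing just added).  `R` always contains the
crossing `p` that was just added. -/
def insertSteps (n : ℤ) : ℕ → Finset (ℤ × ℤ) → ℤ × ℤ → List (Finset (ℤ × ℤ) × (ℤ × ℤ))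
  | 0, _, _ => []
  | fuel + 1, R, p =>
      (R, p) ::
        if IsRC n R then []
        else
          let a := lab n R true p.1 p.2
          let b := lab n R false p.1 p.2
          -- the unique other crossing of the two strands that cross at `p`
          let C := R.filter fun q =>
            q ≠ p ∧ ((lab n R true q.1 q.2 = a ∧ lab n R false q.1 q.2 = b) ∨
                     (lab n R true q.1 q.2 = b ∧ lab n R false q.1 q.2 = a))
          let q := (C.sort rcOrder).headI
          let R' := R.erase q
          let i' := sInf {x : ℤ | q.1 < x ∧ OpenSpace n R' x q.2}
          insertSteps n fuel (insert (i', q.2) R') (i', q.2)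

/-- The trace of the insertion of `k` into `R`: the states of the algorithm together with
the crossings added at each step. -/
def insertStepsOf (n : ℤ) (R : Finset (ℤ × ℤ)) (k : ℤ) : List (Finset (ℤ × ℤ) × (ℤ × ℤ)) :=
  let i₁ := sInf {x : ℤ | OpenSpace n R x k}
  insertSteps n ((n + 1 - k).toNat + 1) (insert (i₁, k) R) (i₁, k)

/-- The insertion `R ← k` of Bergeron and Billey. -/
def insertOne (n : ℤ) (R : Finset (ℤ × ℤ)) (k : ℤ) : Finset (ℤ × ℤ) :=
  ((insertStepsOf n R k).getLast?.getD (R, (0, 0))).1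

/-- The insertion `R ← v` of a word. -/
def insertWord (n : ℤ) (R : Finset (ℤ × ℤ)) (v : List ℕ) : Finset (ℤ × ℤ) :=
  v.foldl (fun S a => insertOne n S (a : ℤ)) R

/-- The column (first coordinate) at which the strand labeled `a` of the diagram `R`
leaves row `r` northward. -/
def strandCol (n : ℤ) (R : Finset (ℤ × ℤ)) (a r : ℤ) : ℤ :=
  sSup {i : ℤ | i ≤ n ∧ northLabel n R i r = a}

/-- Given the trace `L` of an insertion, the column occupied in row `r` by the left path
(`left = true`) or the right path (`left = false`) of the insertion.  Between the rows of
the `t`-th and `(t+1)`-st added crossings, the left path is the piece `s_t` of the strand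
whose label changes from `a_t` to `b_t`, and the right path is the piece `s^t` whose label
changes from `b_t` to `a_t`. -/
def pathCol (n : ℤ) (L : List (Finset (ℤ × ℤ) × (ℤ × ℤ))) (left : Bool) (r : ℤ) : ℤ :=
  match (L.filter fun e => e.2.2 ≤ r).getLast? with
  | some e => strandCol n e.1 (lab n e.1 left e.2.1 e.2.2) r
  | none => 0

/-- A semistandard Young tableau with at most `n` rows (rows indexed `1,…,n`, row `j`
having `μ j` boxes, columns indexed from `0`), with entries in `{1,…,n}`, weakly
increasing along rows and strictly increasing down columns; entries outside the shape
are `0`. -/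
structure SSYT (n : ℕ) (μ : ℕ → ℕ) where
  entry : ℕ → ℕ → ℕ
  entry_mem : ∀ j c, 1 ≤ j → j ≤ n → c < μ j → 1 ≤ entry j c ∧ entry j c ≤ n
  row_weak : ∀ j c₁ c₂, 1 ≤ j → j ≤ n → c₁ ≤ c₂ → c₂ < μ j → entry j c₁ ≤ entry j c₂
  col_strict : ∀ j₁ j₂ c, 1 ≤ j₁ → j₁ < j₂ → j₂ ≤ n → c < μ j₂ → entry j₁ c < entry j₂ c
  outside : ∀ j c, j = 0 ∨ n < j ∨ μ j ≤ c → entry j c = 0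

/-- `μ` is a partition with (at most) `n` parts `μ 1 ≥ μ 2 ≥ … ≥ μ n ≥ 0`
(and `μ j = 0` outside `1,…,n`). -/
def IsPartition (n : ℕ) (μ : ℕ → ℕ) : Prop :=
  (∀ j, 1 ≤ j → j < n → μ (j + 1) ≤ μ j) ∧ ∀ j, j = 0 ∨ n < j → μ j = 0

/-- The reading word of a tableau: the rows read left to right, from the bottom row
to the top one. -/
def readingWord (n : ℕ) (μ : ℕ → ℕ) (Y : SSYT n μ) : List ℕ :=
  ((List.range n).reverse.map (· + 1)).flatMap fun j =>
    (List.range (μ j)).map fun c => Y.entry j c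

/-- An elementary Knuth move. -/
def KnuthMove (w₁ w₂ : List ℕ) : Prop :=
  (∃ (u v : List ℕ) (x y z : ℕ), x < y ∧ y ≤ z ∧
      w₁ = u ++ y :: x :: z :: v ∧ w₂ = u ++ y :: z :: x :: v) ∨
  (∃ (u v : List ℕ) (x y z : ℕ), x ≤ y ∧ y < z ∧
      w₁ = u ++ x :: z :: y :: v ∧ w₂ = u ++ z :: x :: y :: v)

/-- Knuth equivalence: the equivalence relation generated by elementary Knuth moves. -/
def KnuthEquiv (w₁ w₂ : List ℕ) : Prop := Relation.EqvGen KnuthMove w₁ w₂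

/-- The monomial `x^R = ∏_{(i,k) ∈ R} x_k`. -/
def xR (R : Finset (ℤ × ℤ)) : MvPolynomial ℕ ℤ :=
  ∏ p ∈ R, MvPolynomial.X p.2.toNat

/-- The monomial `x^Y = ∏ x_i`, one factor for each entry `i` of `Y`. -/
def xY (n : ℕ) (μ : ℕ → ℕ) (Y : SSYT n μ) : MvPolynomial ℕ ℤ :=
  ((readingWord n μ Y).map MvPolynomial.X).prod

/-- The Schubert polynomial `S_w = Σ_{R : w_R = w} x^R`. -/
def Schub (n : ℤ) (w : Equiv.Perm ℤ) : MvPolynomial ℕ ℤ :=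
  ∑ᶠ R ∈ {R : Finset (ℤ × ℤ) | IsRC n R ∧ wR n R = w}, xR R

/-- The Schur polynomial `s_μ(x₁,…,x_n) = Σ_Y x^Y`, summing over all semistandard Young
tableaux of shape `μ` with entries in `{1,…,n}`. -/
def SchurP (n : ℕ) (μ : ℕ → ℕ) : MvPolynomial ℕ ℤ :=
  ∑ᶠ Y : SSYT n μ, xY n μ Y

/-- The complete homogeneous symmetric polynomial
`h_m = Σ_{1 ≤ i₁ ≤ … ≤ i_m ≤ n} x_{i₁} ⋯ x_{i_m}`. -/
def hPoly (n m : ℕ) : MvPolynomial ℕ ℤ :=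
  ∑ s ∈ (Finset.Icc 1 n).sym m, (s.1.map MvPolynomial.X).prod

/-- The top rc-graph `R(μ) = {(i,k) : 1 ≤ k ≤ n, n - μ_k + 1 ≤ i ≤ n}` of a partition. -/
def Rmu (n : ℕ) (μ : ℕ → ℕ) : Finset (ℤ × ℤ) :=
  (Finset.Icc 1 (n : ℤ)).biUnion fun k =>
    (Finset.Icc ((n : ℤ) - μ k.toNat + 1) (n : ℤ)).image fun i => (i, k)


/-- carrier entering column `c` -/
def hh (r : ℤ) (σ : ℕ → ℤ) (C : Finset ℕ) : ℕ → ℤ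
  | 0 => r
  | c + 1 => if c ∈ C then hh r σ C c else σ c

/-- labels leaving a row northward -/
def outR (r : ℤ) (σ : ℕ → ℤ) (C : Finset ℕ) (c : ℕ) : ℤ :=
  if c ∈ C then σ c else hh r σ C c

inductive Mv where
  | nil : Mv
  | emp : Mv
  | mv : ℕ → ℕ → Mv

def app : Mv → (ℕ → ℤ) → ℕ → ℤ
  | .mv c d, σ => fun x => if x = c then σ d else if x = d then σ c else σ x
  | .nil, σ => σ
  | .emp, σ => σ

def ff (C : Finset ℕ) (c : ℕ) : ℕ := if c ∈ C then c else c + 1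

def Val (r : ℤ) (σ : ℕ → ℤ) (C : Finset ℕ) : Prop :=
  0 < r ∧ ∀ c ∈ C, σ c < hh r σ C c ∧ 0 < hh r σ C c

def VMv (σ : ℕ → ℤ) : Mv → Prop
  | .mv c d => c < d ∧ 0 < σ c ∧ σ d ≤ 0 ∧ ∀ x, c < x → x < d → σ c < σ x
  | .nil => True
  | .emp => True

inductive Step (r : ℤ) (σ : ℕ → ℤ) (C : Finset ℕ) : Mv → Finset ℕ → Mv → Prop
  | nil : Step r σ C .nil C .nil
  | emp (e : ℕ) (h1 : 0 < outR r σ C e) (h2 : ∀ x, e < x → outR r σ C x ≤ 0) :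
      Step r σ C .emp (insert e C) (.mv e (e + 1))
  | bump (c e : ℕ) (hc : c ∉ C) (hd : c + 1 ∈ C) (he : e ≤ c) (h1 : 0 < outR r σ C e)
      (h2 : ∀ x, e < x → x ≤ c → outR r σ C x ≤ 0) :
      Step r σ C (.mv c (c + 1)) (insert e (C.erase (c + 1))) (.mv e (e + 1))
  | keep (c d : ℕ) (hk : ¬ (c ∉ C ∧ d = c + 1 ∧ d ∈ C)) :
      Step r σ C (.mv c d) C (.mv (ff C c) (ff C d))

theorem hh_succ (r : ℤ) (σ : ℕ → ℤ) (C : Finset ℕ) (c : ℕ) :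
    hh r σ C (c + 1) = if c ∈ C then hh r σ C c else σ c := rfl

theorem hh_zero (r : ℤ) (σ : ℕ → ℤ) (C : Finset ℕ) : hh r σ C 0 = r := rfl

theorem hh_in {r : ℤ} {σ : ℕ → ℤ} {C : Finset ℕ} {c : ℕ} (h : c ∈ C) :
    hh r σ C (c + 1) = hh r σ C c := by simp [hh_succ, h]

theorem hh_out {r : ℤ} {σ : ℕ → ℤ} {C : Finset ℕ} {c : ℕ} (h : c ∉ C) :
    hh r σ C (c + 1) = σ c := by simp [hh_succ, h]

theorem out_in {r : ℤ} {σ : ℕ → ℤ} {C : Finset ℕ} {c : ℕ} (h : c ∈ C) :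
    outR r σ C c = σ c := by simp [outR, h]

theorem out_out {r : ℤ} {σ : ℕ → ℤ} {C : Finset ℕ} {c : ℕ} (h : c ∉ C) :
    outR r σ C c = hh r σ C c := by simp [outR, h]

theorem ff_in {C : Finset ℕ} {c : ℕ} (h : c ∈ C) : ff C c = c := by simp [ff, h]
theorem ff_out {C : Finset ℕ} {c : ℕ} (h : c ∉ C) : ff C c = c + 1 := by simp [ff, h]

/-- structure to the right of an open space, below a cutoff `c ∉ C` -/
theorem open_struct {r : ℤ} {σ : ℕ → ℤ} {C : Finset ℕ} (hV : Val r σ C) {c e : ℕ}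
    (hc : c ∉ C) (he : e ≤ c) (h1 : 0 < outR r σ C e)
    (h2 : ∀ x, e < x → x ≤ c → outR r σ C x ≤ 0) :
    e ∉ C ∧ 0 < hh r σ C e ∧ (∀ x, e < x → x ≤ c → x ∉ C ∧ hh r σ C x ≤ 0) ∧
      (∀ x, e ≤ x → x < c → σ x ≤ 0) := by
  obtain ⟨k, rfl⟩ := Nat.exists_eq_add_of_le he
  have key : ∀ j, j ≤ k → (e + (k - j) ∉ C) ∧
      (j < k → hh r σ C (e + (k - j)) ≤ 0) ∧ (0 < j → σ (e + (k - j)) ≤ 0) := by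
    intro j
    induction j with
    | zero =>
      intro _
      refine ⟨by simpa using hc, ?_, by simp⟩
      intro hk
      have := h2 (e + k) (by omega) le_rfl
      rw [out_out hc] at this
      simpa using this
    | succ j ih =>
      intro hj
      obtain ⟨i1, i2, i3⟩ := ih (by omega)
      have e1 : e + (k - j) = (e + (k - (j + 1))) + 1 := by omega
      have i2' := i2 (by omega)
      rw [e1] at i2'
      have hn : e + (k - (j + 1)) ∉ C := by
        intro hin
        rw [hh_in hin] at i2'
        have := (hV.2 _ hin).2
        omega
      refine ⟨hn, ?_, ?_⟩
      · intro hk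
        have := h2 (e + (k - (j + 1))) (by omega) (by omega)
        rwa [out_out hn] at this
      · intro _
        rwa [hh_out hn] at i2'
  have k0 := key k le_rfl
  simp only [Nat.sub_self, Nat.add_zero] at k0
  refine ⟨k0.1, ?_, ?_, ?_⟩
  · rwa [out_out k0.1] at h1
  · intro x hx hx'
    have := key (e + k - x) (by omega)
    rw [show e + (k - (e + k - x)) = x by omega] at this
    exact ⟨this.1, this.2.1 (by omega)⟩
  · intro x hx hx'
    have := key (e + k - x) (by omega)
    rw [show e + (k - (e + k - x)) = x by omega] at this
    exact this.2.2 (by omega)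

theorem exists_large (C : Finset ℕ) (N : ℕ) : ∃ c, N ≤ c ∧ c ∉ C := by
  refine ⟨N + C.sup id + 1, by omega, fun h => ?_⟩
  have := Finset.le_sup (f := id) h
  simp only [id] at this
  omega

theorem emp_struct {r : ℤ} {σ : ℕ → ℤ} {C : Finset ℕ} (hV : Val r σ C) {e : ℕ}
    (h1 : 0 < outR r σ C e) (h2 : ∀ x, e < x → outR r σ C x ≤ 0) :
    e ∉ C ∧ 0 < hh r σ C e ∧ (∀ x, e < x → x ∉ C ∧ hh r σ C x ≤ 0) ∧
      (∀ x, e ≤ x → σ x ≤ 0) := by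
  have key : ∀ N, ∃ c, N ≤ c ∧ e ≤ c ∧ c ∉ C := by
    intro N
    obtain ⟨c, h, h'⟩ := exists_large C (N + e)
    exact ⟨c, by omega, by omega, h'⟩
  have s := fun (c : ℕ) (hc : c ∉ C) (he : e ≤ c) =>
    open_struct hV hc he h1 (fun x hx _ => h2 x hx)
  obtain ⟨c, _, hc, hc'⟩ := key 0
  refine ⟨(s c hc' hc).1, (s c hc' hc).2.1, ?_, ?_⟩
  · intro x hx
    obtain ⟨c, hx', hc, hc'⟩ := key x
    exact (s c hc' hc).2.2.1 x hx hx'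
  · intro x hx
    obtain ⟨c, hx', hc, hc'⟩ := key (x + 1)
    exact (s c hc' hc).2.2.2 x hx (by omega)

/-- carriers beyond a move stay above the moved letter -/
theorem hh_gt {r : ℤ} {σ : ℕ → ℤ} {C : Finset ℕ} (hV : Val r σ C) {c d : ℕ}
    (hm : VMv σ (.mv c d)) (x : ℕ) (hx : ff C c < x) (hxd : x ≤ d) :
    σ c < hh r σ C x := by
  obtain ⟨h1, h2, h3, h4⟩ := hm
  have key : ∀ j, c + 1 + j ≤ d → (c ∉ C → 0 < j) → σ c < hh r σ C (c + 1 + j) := by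
    intro j
    induction j with
    | zero =>
      intro hj hc
      by_cases hcc : c ∈ C
      · rw [Nat.add_zero, hh_in hcc]; exact (hV.2 c hcc).1
      · exact absurd (hc hcc) (by simp)
    | succ j ih =>
      intro hj _
      rw [← Nat.add_assoc]
      by_cases hcc : c + 1 + j ∈ C
      · rw [hh_in hcc]
        exact lt_trans (h4 _ (by omega) (by omega)) (hV.2 _ hcc).1
      · rw [hh_out hcc]; exact h4 _ (by omega) (by omega)
  have : c < x := by unfold ff at hx; split_ifs at hx <;> omega
  have e1 : x = c + 1 + (x - (c + 1)) := by omega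
  rw [e1]
  refine key _ (by omega) ?_
  intro hc
  rw [ff_out hc] at hx
  omega

/-- after a blank carried upwards, no crossing -/
theorem next_out {r : ℤ} {σ : ℕ → ℤ} {C : Finset ℕ} (hV : Val r σ C) {d : ℕ}
    (hd : d ∉ C) (h : σ d ≤ 0) : d + 1 ∉ C := by
  intro hin
  have := (hV.2 _ hin).2
  rw [hh_out hd] at this
  omega

/-- after an unchanged small letter, no crossing -/
theorem keep_next {r : ℤ} {σ : ℕ → ℤ} {C : Finset ℕ} (hV : Val r σ C) {c d : ℕ}
    (hm : VMv σ (.mv c d)) (hk : ¬ (c ∉ C ∧ d = c + 1 ∧ d ∈ C)) (hc : c ∉ C) : c + 1 ∉ C := by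
  intro hin
  obtain ⟨h1, h2, h3, h4⟩ := hm
  by_cases hd : d = c + 1
  · exact hk ⟨hc, hd, hd ▸ hin⟩
  · have := (hV.2 _ hin).1
    rw [hh_out hc] at this
    have := h4 (c + 1) (by omega) (by omega)
    omega

theorem keep_hh {r : ℤ} {σ : ℕ → ℤ} {C : Finset ℕ} (hV : Val r σ C) {c d : ℕ}
    (hm : VMv σ (.mv c d)) (hk : ¬ (c ∉ C ∧ d = c + 1 ∧ d ∈ C)) (x : ℕ) :
    hh r (app (.mv c d) σ) C x =
      if x = c + 1 ∧ c ∉ C then σ d else if x = d + 1 ∧ d ∉ C then σ c else hh r σ C x := by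
  have hcd := hm.1
  induction x with
  | zero => simp [hh_zero]
  | succ x ih =>
    rw [hh_succ, ih]
    have kn := fun h => keep_next hV hm hk h
    have nn := fun h => next_out hV h hm.2.2.1
    by_cases hx : x ∈ C
    · have a1 : ¬ (x = c + 1 ∧ c ∉ C) := fun h => kn h.2 (h.1 ▸ hx)
      have a2 : ¬ (x = d + 1 ∧ d ∉ C) := fun h => nn h.2 (h.1 ▸ hx)
      have a3 : ¬ (x + 1 = c + 1 ∧ c ∉ C) := fun h => h.2 ((by omega : x = c) ▸ hx)
      have a4 : ¬ (x + 1 = d + 1 ∧ d ∉ C) := fun h => h.2 ((by omega : x = d) ▸ hx)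
      rw [if_pos hx, if_neg a1, if_neg a2, if_neg a3, if_neg a4, hh_in hx]
    · rw [if_neg hx, hh_out hx]
      simp only [app, Nat.add_right_cancel_iff]
      by_cases h1 : x = c
      · subst h1; simp [hx]
      · by_cases h2 : x = d
        · subst h2; simp [hx, h1]
        · simp [h1, h2]

theorem ff_mono {C : Finset ℕ} {x y : ℕ} (h : x ≤ y) : ff C x ≤ ff C y := by
  rcases h.eq_or_lt with rfl | h
  · exact le_rfl
  · unfold ff; split_ifs <;> omega

theorem ff_ge (C : Finset ℕ) (x : ℕ) : x ≤ ff C x := by unfold ff; split_ifs <;> omega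
theorem ff_le (C : Finset ℕ) (x : ℕ) : ff C x ≤ x + 1 := by unfold ff; split_ifs <;> omega

theorem keep_lt {C : Finset ℕ} {c d : ℕ} (hcd : c < d)
    (hk : ¬ (c ∉ C ∧ d = c + 1 ∧ d ∈ C)) : ff C c < ff C d := by
  unfold ff
  split_ifs with h1 h2 h2
  · omega
  · omega
  · by_contra hh
    exact hk ⟨h1, by omega, h2⟩
  · omega

theorem out_ffc {r : ℤ} {σ : ℕ → ℤ} {C : Finset ℕ} (hV : Val r σ C) {c d : ℕ}
    (hm : VMv σ (.mv c d)) (hk : ¬ (c ∉ C ∧ d = c + 1 ∧ d ∈ C)) :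
    outR r σ C (ff C c) = σ c := by
  by_cases h : c ∈ C
  · rw [ff_in h, out_in h]
  · rw [ff_out h, out_out (keep_next hV hm hk h), hh_out h]

theorem out_ffd {r : ℤ} {σ : ℕ → ℤ} {C : Finset ℕ} (hV : Val r σ C) {d : ℕ}
    (hm : σ d ≤ 0) : outR r σ C (ff C d) = σ d := by
  by_cases h : d ∈ C
  · rw [ff_in h, out_in h]
  · rw [ff_out h, out_out (next_out hV h hm), hh_out h]

theorem keep_main {r : ℤ} {σ : ℕ → ℤ} {C : Finset ℕ} (hV : Val r σ C) {c d : ℕ}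
    (hm : VMv σ (.mv c d)) (hk : ¬ (c ∉ C ∧ d = c + 1 ∧ d ∈ C)) :
    outR r (app (.mv c d) σ) C = app (.mv (ff C c) (ff C d)) (outR r σ C) ∧
    Val r (app (.mv c d) σ) C ∧ VMv (outR r σ C) (.mv (ff C c) (ff C d)) := by
  have kh := keep_hh hV hm hk
  have oc := out_ffc hV hm hk
  have od := out_ffd hV hm.2.2.1
  have kl := keep_lt hm.1 hk
  have kn := fun h => keep_next hV hm hk h
  have nn := fun h => next_out hV h hm.2.2.1
  have hcd := hm.1
  refine ⟨?_, ⟨hV.1, ?_⟩, kl, by rw [oc]; exact hm.2.1, by rw [od]; exact hm.2.2.1, ?_⟩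
  · funext x
    have sv : ∀ x, app (.mv c d) σ x = if x = c then σ d else if x = d then σ c else σ x :=
      fun _ => rfl
    show outR r (app (.mv c d) σ) C x = if x = ff C c then outR r σ C (ff C d) else
      if x = ff C d then outR r σ C (ff C c) else outR r σ C x
    rw [oc, od]
    by_cases hx : x ∈ C
    · rw [out_in hx, out_in hx, sv]
      have e1 : (x = ff C c) ↔ x = c := by
        constructor
        · intro h
          by_contra hne
          by_cases hc : c ∈ C
          · rw [ff_in hc] at h; exact hne h
          · rw [ff_out hc] at h; exact kn hc (h ▸ hx)
        · rintro rfl; rw [ff_in hx]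
      have e2 : (x = ff C d) ↔ x = d := by
        constructor
        · intro h
          by_contra hne
          by_cases hc : d ∈ C
          · rw [ff_in hc] at h; exact hne h
          · rw [ff_out hc] at h; exact nn hc (h ▸ hx)
        · rintro rfl; rw [ff_in hx]
      simp only [e1, e2]
    · rw [out_out hx, out_out hx]
      rw [kh]
      have e1 : (x = c + 1 ∧ c ∉ C) ↔ x = ff C c := by
        by_cases hc : c ∈ C
        · rw [ff_in hc]
          simp only [hc, not_true, and_false, false_iff]
          rintro rfl; exact hx hc
        · rw [ff_out hc]; simp [hc]
      have e2 : (x = d + 1 ∧ d ∉ C) ↔ x = ff C d := by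
        by_cases hc : d ∈ C
        · rw [ff_in hc]
          simp only [hc, not_true, and_false, false_iff]
          rintro rfl; exact hx hc
        · rw [ff_out hc]; simp [hc]
      simp only [e1, e2]
  · intro x hx
    have v := hV.2 x hx
    rw [kh]
    have a1 : ¬ (x = c + 1 ∧ c ∉ C) := fun h => kn h.2 (h.1 ▸ hx)
    have a2 : ¬ (x = d + 1 ∧ d ∉ C) := fun h => nn h.2 (h.1 ▸ hx)
    rw [if_neg a1, if_neg a2]
    refine ⟨?_, v.2⟩
    simp only [app]
    split_ifs with h1 h2
    · have := hm.2.2.1; omega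
    · subst h2
      refine hh_gt hV hm x ?_ le_rfl
      rwa [ff_in hx] at kl
    · exact v.1
  · intro x hx hx'
    rw [oc]
    have fd := ff_le C d
    have : ff C c < x ∧ x ≤ d := ⟨hx, by omega⟩
    by_cases hxC : x ∈ C
    · rw [out_in hxC]
      have := ff_ge C c
      refine hm.2.2.2 x (by omega) ?_
      rcases this with h
      by_contra hcon
      have : x = d := by omega
      subst this
      rw [ff_in hxC] at hx'
      omega
    · rw [out_out hxC]
      exact hh_gt hV hm x hx (by omega)

theorem bump_main {r : ℤ} {σ : ℕ → ℤ} {C : Finset ℕ} (hV : Val r σ C) {c e : ℕ}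
    (hm : VMv σ (.mv c (c + 1))) (hc : c ∉ C) (hd : c + 1 ∈ C) (he : e ≤ c)
    (h1 : 0 < outR r σ C e) (h2 : ∀ x, e < x → x ≤ c → outR r σ C x ≤ 0) :
    outR r (app (.mv c (c + 1)) σ) (insert e (C.erase (c + 1))) =
      app (.mv e (e + 1)) (outR r σ C) ∧
    Val r (app (.mv c (c + 1)) σ) (insert e (C.erase (c + 1))) ∧
    VMv (outR r σ C) (.mv e (e + 1)) := by
  obtain ⟨s1, s2, s3, s4⟩ := open_struct hV hc he h1 h2
  obtain ⟨m1, m2, m3, m4⟩ := hm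
  have hmem : ∀ x, x ∈ insert e (C.erase (c + 1)) ↔ x = e ∨ (x ≠ c + 1 ∧ x ∈ C) := by
    intro x; simp
  set C' := insert e (C.erase (c + 1)) with hC'
  set σ' := app (.mv c (c + 1)) σ with hσ'
  have sv : ∀ x, σ' x = if x = c then σ (c + 1) else if x = c + 1 then σ c else σ x := fun x => rfl
  have kh : ∀ x, hh r σ' C' x = if x = e + 1 then hh r σ C e else
      if x = c + 1 then σ (c + 1) else hh r σ C x := by
    intro x
    induction x with
    | zero => simp [hh_zero]
    | succ x ih =>
      rw [hh_succ, ih]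
      by_cases hxe : x = e
      · subst hxe
        have : ¬ (x = c + 1) := by omega
        simp [hmem, this]
      · by_cases hxc : x = c
        · subst hxc
          have : x ∉ C' := by rw [hmem]; simp [hxe, hc]
          simp [this, hxe, sv]
        · by_cases hxd : x = c + 1
          · subst hxd
            have : c + 1 ∉ C' := by rw [hmem]; simp [hxe]
            rw [if_neg this, hh_in hd, hh_out hc, sv]
            simp [hxe]
          · by_cases hx : x ∈ C
            · have h3 : x ∈ C' := by rw [hmem]; exact Or.inr ⟨hxd, hx⟩
              have h4 : ¬ (x = e + 1) := by
                rintro rfl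
                exact (s3 (e + 1) (by omega) (by omega)).1 hx
              simp [h3, hh_in hx, hxe, hxc, h4, hxd]
            · have h3 : x ∉ C' := by rw [hmem]; simp [hxe, hx]
              simp [h3, hh_out hx, hxe, hxc, hxd, sv]
  have oe1 : outR r σ C (e + 1) = if e = c then σ (c + 1) else σ e := by
    by_cases hec : e = c
    · subst hec; simp [out_in hd]
    · have := (s3 (e + 1) (by omega) (by omega)).1
      rw [out_out this, hh_out s1, if_neg hec]
  refine ⟨?_, ⟨hV.1, ?_⟩, by omega, h1, ?_, fun x hx hx' => by omega⟩
  · funext x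
    simp only [app]
    by_cases hxe : x = e
    · subst hxe
      have : x ∈ C' := by rw [hmem]; simp
      rw [out_in this, if_pos rfl, oe1, sv]
      have : ¬ (x = c + 1) := by omega
      simp [this]
    · rw [if_neg hxe]
      by_cases hxe1 : x = e + 1
      · rw [if_pos hxe1]
        have : x ∉ C' := by
          rw [hmem, hxe1]
          rintro (h | ⟨h, h'⟩)
          · omega
          · exact (s3 (e + 1) (by omega) (by omega)).1 h'
        rw [out_out this, kh, if_pos hxe1, out_out s1]
      · rw [if_neg hxe1]
        by_cases hxd : x = c + 1
        · subst hxd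
          have : c + 1 ∉ C' := by rw [hmem]; simp [hxe]
          rw [out_out this, kh, if_neg hxe1, if_pos rfl, out_in hd]
        · by_cases hx : x ∈ C
          · have h3 : x ∈ C' := by rw [hmem]; exact Or.inr ⟨hxd, hx⟩
            have h4 : x ≠ c := by rintro rfl; exact hc hx
            rw [out_in h3, out_in hx, sv, if_neg h4, if_neg hxd]
          · have h3 : x ∉ C' := by rw [hmem]; simp [hxe, hx]
            rw [out_out h3, out_out hx, kh, if_neg hxe1, if_neg hxd]
  · intro x hx
    rw [hmem] at hx
    rcases hx with rfl | ⟨hx, hx'⟩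
    · rw [kh, if_neg (by omega), if_neg (by omega)]
      refine ⟨?_, s2⟩
      rw [sv]
      split_ifs with q1 q2
      · omega
      · omega
      · have := s4 x le_rfl (by omega)
        omega
    · have h4 : ¬ (x = e + 1) := by
        rintro rfl
        exact (s3 (e + 1) (by omega) (by omega)).1 hx'
      have h5 : x ≠ c := by rintro rfl; exact hc hx'
      rw [kh, if_neg h4, if_neg hx, sv, if_neg h5, if_neg hx]
      exact hV.2 x hx'
  · rw [oe1]
    split_ifs with q
    · exact m3
    · exact s4 e le_rfl (by omega)

theorem emp_main {r : ℤ} {σ : ℕ → ℤ} {C : Finset ℕ} (hV : Val r σ C) {e : ℕ}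
    (h1 : 0 < outR r σ C e) (h2 : ∀ x, e < x → outR r σ C x ≤ 0) :
    outR r σ (insert e C) = app (.mv e (e + 1)) (outR r σ C) ∧
    Val r σ (insert e C) ∧ VMv (outR r σ C) (.mv e (e + 1)) := by
  obtain ⟨s1, s2, s3, s4⟩ := emp_struct hV h1 h2
  have hmem : ∀ x, x ∈ insert e C ↔ x = e ∨ x ∈ C := by
    intro x; simp
  set C' := insert e C with hC'
  have kh : ∀ x, hh r σ C' x = if x = e + 1 then hh r σ C e else hh r σ C x := by
    intro x
    induction x with
    | zero => simp [hh_zero]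
    | succ x ih =>
      rw [hh_succ, ih]
      by_cases hxe : x = e
      · subst hxe
        simp [hmem]
      · by_cases hx : x ∈ C
        · have h3 : x ∈ C' := by rw [hmem]; exact Or.inr hx
          have h4 : ¬ (x = e + 1) := by
            rintro rfl
            exact (s3 (e + 1) (by omega)).1 hx
          simp [h3, hh_in hx, hxe, h4]
        · have h3 : x ∉ C' := by rw [hmem]; simp [hxe, hx]
          simp [h3, hh_out hx, hxe]
  have oe1 : outR r σ C (e + 1) = σ e := by
    rw [out_out (s3 (e + 1) (by omega)).1, hh_out s1]
  refine ⟨?_, ⟨hV.1, ?_⟩, by omega, h1, h2 _ (by omega), fun x hx hx' => by omega⟩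
  · funext x
    simp only [app]
    by_cases hxe : x = e
    · subst hxe
      have : x ∈ C' := by rw [hmem]; simp
      rw [out_in this, if_pos rfl, oe1]
    · rw [if_neg hxe]
      by_cases hxe1 : x = e + 1
      · rw [if_pos hxe1]
        have : x ∉ C' := by
          rw [hmem, hxe1]
          rintro (h | h')
          · omega
          · exact (s3 (e + 1) (by omega)).1 h'
        rw [out_out this, kh, if_pos hxe1, out_out s1]
      · rw [if_neg hxe1]
        by_cases hx : x ∈ C
        · have h3 : x ∈ C' := by rw [hmem]; exact Or.inr hx
          rw [out_in h3, out_in hx]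
        · have h3 : x ∉ C' := by rw [hmem]; simp [hxe, hx]
          rw [out_out h3, out_out hx, kh, if_neg hxe1]
  · intro x hx
    rw [hmem] at hx
    rcases hx with rfl | hx'
    · rw [kh, if_neg (by omega)]
      refine ⟨?_, s2⟩
      have := s4 x le_rfl
      omega
    · have h4 : ¬ (x = e + 1) := by
        rintro rfl
        exact (s3 (e + 1) (by omega)).1 hx'
      rw [kh, if_neg h4]
      exact hV.2 x hx'

theorem step_main {r : ℤ} {σ : ℕ → ℤ} {C C' : Finset ℕ} {m o : Mv} (hV : Val r σ C)
    (hm : VMv σ m) (hs : Step r σ C m C' o) :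
    outR r (app m σ) C' = app o (outR r σ C) ∧ Val r (app m σ) C' ∧ VMv (outR r σ C) o := by
  cases hs with
  | nil => exact ⟨rfl, hV, trivial⟩
  | emp e h1 h2 => exact emp_main hV h1 h2
  | bump c e hc hd he h1 h2 => exact bump_main hV hm hc hd he h1 h2
  | keep c d hk => exact keep_main hV hm hk

theorem step_det {r : ℤ} {σ : ℕ → ℤ} {C C1 C2 : Finset ℕ} {m o1 o2 : Mv}
    (h1 : Step r σ C m C1 o1) (h2 : Step r σ C m C2 o2) : C1 = C2 ∧ o1 = o2 := by
  cases h1 with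
  | nil => cases h2; exact ⟨rfl, rfl⟩
  | emp e a1 a2 =>
    cases h2 with
    | emp e' b1 b2 =>
      have : e = e' := by
        rcases lt_trichotomy e e' with h | h | h
        · have := a2 _ h; omega
        · exact h
        · have := b2 _ h; omega
      subst this; exact ⟨rfl, rfl⟩
  | bump c e hc hd he a1 a2 =>
    cases h2 with
    | bump _ e' _ _ he' b1 b2 =>
      have : e = e' := by
        rcases lt_trichotomy e e' with h | h | h
        · have := a2 _ h he'; omega
        · exact h
        · have := b2 _ h he; omega
      subst this; exact ⟨rfl, rfl⟩
    | keep _ _ hk => exact absurd ⟨hc, rfl, hd⟩ hk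
  | keep c d hk =>
    cases h2 with
    | bump _ e' hc hd _ _ _ => exact absurd ⟨hc, rfl, hd⟩ hk
    | keep _ _ _ => exact ⟨rfl, rfl⟩

/-- there is a positive label at or before any non-crossing column -/
theorem exists_pos {r : ℤ} {σ : ℕ → ℤ} {C : Finset ℕ} (hV : Val r σ C) {c : ℕ} (hc : c ∉ C) :
    ∃ e, e ≤ c ∧ 0 < outR r σ C e := by
  by_contra hcon
  push Not at hcon
  have : ∀ x, x ≤ c → 0 < hh r σ C x := by
    intro x
    induction x with
    | zero => intro _; exact hV.1
    | succ x ih =>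
      intro hx
      have i := ih (by omega)
      by_cases hxC : x ∈ C
      · rwa [hh_in hxC]
      · have := hcon x (by omega)
        rw [out_out hxC] at this
        omega
  have h1 := this c le_rfl
  have h2 := hcon c le_rfl
  rw [out_out hc] at h2
  omega

theorem step_exists {r : ℤ} {σ : ℕ → ℤ} {C : Finset ℕ} (hV : Val r σ C)
    (hfin : ∃ N, ∀ x, N ≤ x → σ x ≤ 0) (m : Mv) : ∃ C' o, Step r σ C m C' o := by
  cases m with
  | nil => exact ⟨_, _, .nil⟩
  | emp =>
    obtain ⟨N, hN⟩ := hfin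
    set B := N + C.sup id + 1 with hB
    have hCB : ∀ x, B ≤ x → x ∉ C := by
      intro x hx h
      have := Finset.le_sup (f := id) h
      simp only [id] at this; omega
    obtain ⟨e0, he0, hp⟩ := exists_pos hV (hCB B le_rfl)
    have hout : ∀ x, B < x → outR r σ C x ≤ 0 := by
      intro x hx
      obtain ⟨y, rfl⟩ : ∃ y, x = y + 1 := ⟨x - 1, by omega⟩
      rw [out_out (hCB _ (by omega)), hh_out (hCB _ (by omega))]
      exact hN _ (by omega)
    refine ⟨_, _, .emp (Nat.findGreatest (fun e => 0 < outR r σ C e) B) ?_ ?_⟩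
    · exact Nat.findGreatest_spec (P := fun e => 0 < outR r σ C e) he0 hp
    · intro x hx
      by_cases hxB : x ≤ B
      · have := Nat.findGreatest_is_greatest hx hxB
        omega
      · exact hout x (by omega)
  | mv c d =>
    by_cases hk : c ∉ C ∧ d = c + 1 ∧ d ∈ C
    · obtain ⟨hc, rfl, hd⟩ := hk
      obtain ⟨e0, he0, hp⟩ := exists_pos hV hc
      refine ⟨_, _, .bump c (Nat.findGreatest (fun e => 0 < outR r σ C e) c) hc hd
        (Nat.findGreatest_le _) ?_ ?_⟩
      · exact Nat.findGreatest_spec (P := fun e => 0 < outR r σ C e) he0 hp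
      · intro x hx hxc
        have := Nat.findGreatest_is_greatest hx hxc
        omega
    · exact ⟨_, _, .keep c d hk⟩

def actv (C : Finset ℕ) : Mv → Prop
  | .nil => False
  | .emp => True
  | .mv c d => c ∉ C ∧ d = c + 1 ∧ d ∈ C

def cut : Mv → ℕ → Prop
  | .nil, _ => False
  | .emp, _ => True
  | .mv c _, x => x ≤ c

def rmv (C : Finset ℕ) : Mv → Finset ℕ
  | .nil => C
  | .emp => C
  | .mv _ d => C.erase d

def LE' : Mv → Mv → Prop
  | .mv _ d, .mv c _ => d ≤ c
  | .mv _ _, .emp => True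
  | .emp, .emp => True
  | .emp, .mv _ _ => False
  | .nil, .nil => True
  | .nil, _ => False
  | _, .nil => True

def LT' : Mv → Mv → Prop
  | .mv _ d, .mv c _ => d ≤ c
  | .mv _ _, .emp => True
  | .emp, .emp => False
  | .emp, .mv _ _ => False
  | .nil, .nil => True
  | .nil, _ => False
  | _, .nil => True

def SEP : Mv → Mv → Prop
  | .mv _ d, .mv c _ => d < c
  | .mv _ _, .emp => True
  | .emp, .emp => False
  | .emp, .mv _ _ => False
  | .nil, .nil => True
  | .nil, _ => False
  | _, .nil => True

theorem app_mv (c d : ℕ) (σ : ℕ → ℤ) (x : ℕ) :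
    app (.mv c d) σ x = if x = c then σ d else if x = d then σ c else σ x := rfl

theorem act_of_step {r : ℤ} {σ : ℕ → ℤ} {C C' : Finset ℕ} {m o : Mv}
    (hs : Step r σ C m C' o) (ha : actv C m) : ∃ e, C' = insert e (rmv C m) ∧ o = .mv e (e + 1) ∧
      cut m e ∧ 0 < outR r σ C e ∧ ∀ x, e < x → cut m x → outR r σ C x ≤ 0 := by
  cases hs with
  | nil => exact absurd ha (by simp [actv])
  | emp e h1 h2 => exact ⟨e, rfl, rfl, trivial, h1, fun x hx _ => h2 x hx⟩
  | bump c e hc hd he h1 h2 => exact ⟨e, rfl, rfl, he, h1, h2⟩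
  | keep c d hk => exact absurd ha hk

theorem step_of_act {r : ℤ} {σ : ℕ → ℤ} {C : Finset ℕ} {m : Mv} (ha : actv C m) {e : ℕ}
    (h0 : cut m e) (h1 : 0 < outR r σ C e) (h2 : ∀ x, e < x → cut m x → outR r σ C x ≤ 0) :
    Step r σ C m (insert e (rmv C m)) (.mv e (e + 1)) := by
  cases m with
  | nil => exact absurd ha (by simp [actv])
  | emp => exact .emp e h1 (fun x hx => h2 x hx trivial)
  | mv c d =>
    obtain ⟨hc, rfl, hd⟩ := ha
    exact .bump c e hc hd h0 h1 h2

theorem keep_of_step {r : ℤ} {σ : ℕ → ℤ} {C C' : Finset ℕ} {c d : ℕ} {o : Mv}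
    (hs : Step r σ C (.mv c d) C' o) (ha : ¬ actv C (.mv c d)) :
    C' = C ∧ o = .mv (ff C c) (ff C d) :=
  step_det hs (.keep c d ha)

theorem act_struct {r : ℤ} {σ : ℕ → ℤ} {C : Finset ℕ} (hV : Val r σ C) {m : Mv}
    (ha : actv C m) {e : ℕ}
    (h0 : cut m e) (h1 : 0 < outR r σ C e) (h2 : ∀ x, e < x → cut m x → outR r σ C x ≤ 0) :
    e ∉ C ∧ 0 < hh r σ C e ∧ (∀ x, e < x → cut m x → x ∉ C ∧ hh r σ C x ≤ 0) ∧
      (∀ x, e ≤ x → cut m (x + 1) → σ x ≤ 0) := by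
  cases m with
  | nil => exact absurd ha (by simp [actv])
  | emp =>
    obtain ⟨a, b, c, d⟩ := emp_struct hV h1 (fun x hx => h2 x hx trivial)
    exact ⟨a, b, fun x hx _ => c x hx, fun x hx _ => d x hx⟩
  | mv c d => exact open_struct hV ha.1 h0 h1 h2

theorem left_of {σ : ℕ → ℤ} {c d e : ℕ} (hm : VMv σ (.mv c d))
    (h : ∀ x, e ≤ x → x < d → σ x ≤ 0) : d ≤ e := by
  obtain ⟨h1, h2, h3, h4⟩ := hm
  by_contra hcon
  by_cases hc : e ≤ c
  · have := h c hc h1; omega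
  · have := h e le_rfl (by omega)
    have := h4 e (by omega) (by omega)
    omega

theorem le_lemma {r : ℤ} {σ : ℕ → ℤ} {C C1 C2 : Finset ℕ} {m1 m2 o1 o2 : Mv} (hV : Val r σ C)
    (v1 : VMv σ m1) (s1 : Step r σ C m1 C1 o1)
    (s2 : Step r (app m1 σ) C1 m2 C2 o2) (h : LE' m1 m2) : LE' o1 o2 := by
  obtain ⟨p1, p2, p3⟩ := step_main hV v1 s1
  by_cases ha : actv C1 m2
  · obtain ⟨e, rfl, rfl, e1, e2, e3⟩ := act_of_step s2 ha
    have hmv : ∃ c' d', o1 = .mv c' d' ∧ (cut m2 d' → d' ≤ e) := by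
      cases o1 with
      | nil =>
        cases s1
        cases m2 <;> simp [LE', actv] at h ha
      | emp => cases s1
      | mv c' d' =>
        refine ⟨c', d', rfl, fun hc => ?_⟩
        by_contra hcon
        have := e3 d' (by omega) hc
        rw [p1, app_mv, if_pos rfl, if_neg (by have := p3.1; omega)] at this
        have := p3.2.1
        omega
    obtain ⟨c', d', rfl, hd⟩ := hmv
    show d' ≤ e
    apply hd
    cases m2 with
    | nil => exact ha
    | emp => trivial
    | mv c2 d2 =>
      show d' ≤ c2
      cases s1 with
      | emp _ _ _ => exact absurd h (by simp [LE'])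
      | bump c e hc hd he h1 h2 =>
        have : c + 1 ≤ c2 := h
        omega
      | keep c d hk =>
        have hh : d ≤ c2 := h
        by_cases hdC : d ∈ C
        · rw [ff_in hdC]; exact hh
        · have := next_out hV hdC v1.2.2.1
          rw [ff_out hdC]
          by_contra hcon
          have : c2 = d := by omega
          subst this
          obtain ⟨a1, a2, a3⟩ := ha
          subst a2
          exact this a3
  · cases m2 with
    | nil => cases s2; cases s1 <;> trivial
    | emp => exact absurd trivial ha
    | mv c2 d2 =>
      obtain ⟨rfl, rfl⟩ := keep_of_step s2 ha
      cases s1 with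
      | nil => exact absurd h (by simp [LE'])
      | emp _ _ _ => exact absurd h (by simp [LE'])
      | bump c e hc hd he h1 h2 =>
        have : c + 1 ≤ c2 := h
        show e + 1 ≤ ff _ c2
        have := ff_ge (insert e (C.erase (c + 1))) c2
        omega
      | keep c d hk =>
        exact ff_mono h

theorem cut_app {σ : ℕ → ℤ} {m : Mv} {x : ℕ} (h : cut m (x + 1)) (hv : VMv σ m) :
    app m σ x = σ x := by
  cases m with
  | nil => rfl
  | emp => rfl
  | mv c d =>
    have : x + 1 ≤ c := h
    have := hv.1
    rw [app_mv, if_neg (by omega), if_neg (by omega)]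

theorem lt_lemma {r : ℤ} {σ : ℕ → ℤ} {C C1 C2 : Finset ℕ} {m1 m2 o1 o2 : Mv} (hV : Val r σ C)
    (v1 : VMv σ m1) (s1 : Step r σ C m1 C1 o1) (v2 : VMv (app m1 σ) m2)
    (s2 : Step r (app m1 σ) C1 m2 C2 o2) (h : LT' m2 m1) : LT' o2 o1 := by
  by_cases ha : actv C m1
  · obtain ⟨e, rfl, rfl, e1, e2, e3⟩ := act_of_step s1 ha
    obtain ⟨t1, t2, t3, t4⟩ := act_struct hV ha e1 e2 e3
    cases m2 with
    | nil => cases m1 <;> simp [LT', actv] at h ha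
    | emp => cases m1 <;> simp [LT', actv] at h ha
    | mv c2 d2 =>
      have hc : ∀ x, x < d2 → cut m1 (x + 1) := by
        intro x hx
        cases m1 with
        | nil => exact ha
        | emp => trivial
        | mv c d =>
          have : d2 ≤ c := h
          show x + 1 ≤ c
          omega
      have hde : d2 ≤ e := by
        refine left_of v2 fun x hx hx' => ?_
        rw [cut_app (hc x hx') v1]
        exact t4 x hx (hc x hx')
      cases s2 with
      | bump c e' hc hd he h1 h2 =>
        show e' + 1 ≤ e
        omega
      | keep _ _ hk =>
        show ff _ d2 ≤ e
        rcases hde.eq_or_lt with hh | hh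
        · rw [hh, ff_in (by simp)]
        · have := ff_le (insert e (rmv C m1)) d2
          omega
  · cases m1 with
    | nil => cases s1; cases s2 <;> trivial
    | emp => exact absurd trivial ha
    | mv c1 d1 =>
      obtain ⟨rfl, rfl⟩ := keep_of_step s1 ha
      cases s2 with
      | nil => exact absurd h (by simp [LT'])
      | emp _ _ _ => exact absurd h (by simp [LT'])
      | bump c e hc hd he h1 h2 =>
        have : c + 1 ≤ c1 := h
        show e + 1 ≤ ff _ c1
        have := ff_ge C1 c1
        omega
      | keep c d hk =>
        exact ff_mono h

theorem mem_ins_rmv {C : Finset ℕ} {c d e x : ℕ} :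
    x ∈ insert e (rmv C (.mv c d)) ↔ x = e ∨ (x ≠ d ∧ x ∈ C) := by
  simp [rmv]

theorem ff_congr {C D : Finset ℕ} {x : ℕ} (h : x ∈ C ↔ x ∈ D) : ff C x = ff D x := by
  simp [ff, h]

theorem mem_ins_rmv' {C : Finset ℕ} {z : Mv} {e x : ℕ} (ha : actv C z) (he : cut z e)
    (hx : cut z x) : x ∈ insert e (rmv C z) ↔ x = e ∨ x ∈ C := by
  cases z with
  | nil => simp [rmv]
  | emp => simp [rmv]
  | mv c d =>
    obtain ⟨h1, rfl, h3⟩ := ha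
    have : x ≤ c := hx
    have h4 : x ≠ c + 1 := by omega
    simp [rmv, h4]

theorem cut_le {z : Mv} {x y : ℕ} (h : x ≤ y) (hy : cut z y) : cut z x := by
  cases z with
  | nil => exact hy
  | emp => trivial
  | mv c d =>
    have : y ≤ c := hy
    show x ≤ c
    omega

theorem comm_lemma {r : ℤ} {σ : ℕ → ℤ} {C C1 C12 C2 C21 : Finset ℕ} {x z ox oz ox' oz' : Mv}
    (hV : Val r σ C) (vx : VMv σ x) (vz : VMv σ z)
    (s1 : Step r σ C x C1 ox) (s2 : Step r (app x σ) C1 z C12 oz)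
    (s3 : Step r σ C z C2 oz') (s4 : Step r (app z σ) C2 x C21 ox') (hsep : SEP x z) :
    (∃ c d, x = .mv c d ∧ d ∉ C ∧ oz' = .mv d (d + 1) ∧ actv C z ∧ cut z (d + 1)) ∨
      (ox = ox' ∧ oz = oz' ∧ C12 = C21) := by
  cases x with
  | nil =>
    right
    cases z <;> simp [SEP] at hsep
    cases s1; cases s2; cases s3; cases s4
    exact ⟨rfl, rfl, rfl⟩
  | emp =>
    right
    cases z <;> simp [SEP] at hsep
    cases s2; cases s3
    obtain ⟨rfl, rfl⟩ := step_det s1 s4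
    exact ⟨rfl, rfl, rfl⟩
  | mv c d =>
    have hcd := vx.1
    by_cases hz : actv C z
    · obtain ⟨ez, rfl, rfl, e1, e2, e3⟩ := act_of_step s3 hz
      obtain ⟨t1, t2, t3, t4⟩ := act_struct hV hz e1 e2 e3
      have hdz : cut z (d + 1) := by
        cases z with
        | nil => exact hz
        | emp => trivial
        | mv c2 d2 =>
          have : d < c2 := hsep
          show d + 1 ≤ c2
          omega
      have hde : d ≤ ez := left_of vx fun x hx hx' => t4 x hx (cut_le (by omega) hdz)
      rcases hde.eq_or_lt with heq | hlt
      · left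
        exact ⟨c, d, rfl, heq ▸ t1, by rw [heq], hz, hdz⟩
      right
      have vo := (step_main hV vz s3).1
      have mem : ∀ x, x ≤ d → (x ∈ insert ez (rmv C z) ↔ x ∈ C) := by
        intro x hx
        rw [mem_ins_rmv' hz e1 (cut_le (by omega) hdz)]
        constructor
        · rintro (h | h)
          · omega
          · exact h
        · exact Or.inr
      by_cases hx : actv C (.mv c d)
      · obtain ⟨e, rfl, rfl, f1, f2, f3⟩ := act_of_step s1 hx
        obtain ⟨x1, rfl, x3⟩ := hx
        have f1' : e ≤ c := f1
        have h4 : Step r (app z σ) (insert ez (rmv C z)) (.mv c (c + 1))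
            (insert e (rmv (insert ez (rmv C z)) (.mv c (c + 1)))) (.mv e (e + 1)) := by
          apply step_of_act
          · refine ⟨?_, rfl, ?_⟩
            · rwa [mem _ (by omega)]
            · rwa [mem _ (by omega)]
          · exact f1
          · rw [vo, app_mv, if_neg (by omega), if_neg (by omega)]; exact f2
          · intro x hx hx'
            have : x ≤ c := hx'
            rw [vo, app_mv, if_neg (by omega), if_neg (by omega)]; exact f3 x hx hx'
        obtain ⟨rfl, rfl⟩ := step_det s4 h4
        have wo := (step_main hV vx s1).1
        have h2 : Step r (app (.mv c (c + 1)) σ) (insert e (rmv C (.mv c (c + 1)))) z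
            (insert ez (rmv (insert e (rmv C (.mv c (c + 1)))) z)) (.mv ez (ez + 1)) := by
          apply step_of_act
          · cases z with
            | nil => exact hz
            | emp => trivial
            | mv c2 d2 =>
              obtain ⟨z1, z2, z3⟩ := hz
              have h0 : c + 1 < c2 := hsep
              refine ⟨?_, z2, ?_⟩
              · rw [mem_ins_rmv]
                rintro (h | h)
                · omega
                · exact z1 h.2
              · rw [mem_ins_rmv]
                exact Or.inr ⟨by omega, z3⟩
          · exact e1
          · rw [wo, app_mv, if_neg (by omega), if_neg (by omega)]; exact e2
          · intro x hx hx'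
            rw [wo, app_mv, if_neg (by omega), if_neg (by omega)]; exact e3 x hx hx'
        obtain ⟨rfl, rfl⟩ := step_det s2 h2
        refine ⟨rfl, rfl, ?_⟩
        cases z with
        | nil => exact absurd hz id
        | emp =>
          ext x
          simp only [rmv, Finset.mem_insert, Finset.mem_erase]
          constructor
          · rintro (h | h | h)
            · right; exact ⟨by omega, Or.inl h⟩
            · exact Or.inl h
            · right; exact ⟨h.1, Or.inr h.2⟩
          · rintro (h | ⟨h, h' | h'⟩)
            · exact Or.inr (Or.inl h)
            · exact Or.inl h'
            · exact Or.inr (Or.inr ⟨h, h'⟩)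
        | mv c2 d2 =>
          have h0 : c + 1 < c2 := hsep
          obtain ⟨z1, rfl, z3⟩ := hz
          have e1' : ez ≤ c2 := e1
          ext x
          simp only [rmv, Finset.mem_insert, Finset.mem_erase]
          by_cases q1 : x = e
          · have : x ≠ c2 + 1 := by omega
            simp [q1]; omega
          · by_cases q2 : x = ez
            · simp [q2]; omega
            · simp only [q1, q2, false_or]; tauto
      · obtain ⟨rfl, rfl⟩ := keep_of_step s1 hx
        have hx' : ¬ actv (insert ez (rmv C1 z)) (.mv c d) := by
          intro ⟨a, b, e⟩
          rw [mem _ (by omega)] at a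
          rw [mem _ (by omega)] at e
          exact hx ⟨a, b, e⟩
        obtain ⟨rfl, rfl⟩ := keep_of_step s4 hx'
        have wo := (step_main hV vx s1).1
        have hod := out_ffd hV vx.2.2.1
        have hfd : ff C1 d < ez := by
          have := ff_le C1 d
          by_contra hcon
          have : ez = ff C1 d := by omega
          rw [this, hod] at e2
          have := vx.2.2.1
          omega
        have hfc : ff C1 c ≤ ff C1 d := ff_mono hcd.le
        have h2 : Step r (app (.mv c d) σ) C1 z
            (insert ez (rmv C1 z)) (.mv ez (ez + 1)) := by
          apply step_of_act hz e1
          · rw [wo, app_mv, if_neg (by omega), if_neg (by omega)]; exact e2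
          · intro x hx hx'
            rw [wo, app_mv, if_neg (by omega), if_neg (by omega)]; exact e3 x hx hx'
        obtain ⟨rfl, rfl⟩ := step_det s2 h2
        refine ⟨?_, rfl, rfl⟩
        rw [ff_congr (mem c (by omega)), ff_congr (mem d (by omega))]
    · right
      cases z with
      | nil =>
        cases s2; cases s3
        obtain ⟨rfl, rfl⟩ := step_det s1 s4
        exact ⟨rfl, rfl, rfl⟩
      | emp => exact absurd trivial hz
      | mv c2 d2 =>
        have h0 : d < c2 := hsep
        have hcd2 := vz.1
        obtain ⟨rfl, rfl⟩ := keep_of_step s3 hz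
        have vo := (step_main hV vz s3).1
        by_cases hx : actv C2 (.mv c d)
        · obtain ⟨e, rfl, rfl, f1, f2, f3⟩ := act_of_step s1 hx
          obtain ⟨x1, rfl, x3⟩ := hx
          have f1' : e ≤ c := f1
          have g1 := ff_ge C2 c2
          have g2 := ff_ge C2 d2
          have h4 : Step r (app (.mv c2 d2) σ) C2 (.mv c (c + 1))
            (insert e (rmv C2 (.mv c (c + 1)))) (.mv e (e + 1)) := by
            apply step_of_act (show actv C2 (.mv c (c + 1)) from ⟨x1, rfl, x3⟩) f1
            · rw [vo, app_mv, if_neg (by omega), if_neg (by omega)]; exact f2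
            · intro x hx hx'
              have : x ≤ c := hx'
              rw [vo, app_mv, if_neg (by omega), if_neg (by omega)]; exact f3 x hx hx'
          obtain ⟨rfl, rfl⟩ := step_det s4 h4
          have mem : ∀ x, c + 1 < x → (x ∈ insert e (rmv C2 (.mv c (c + 1))) ↔ x ∈ C2) := by
            intro x hx
            rw [mem_ins_rmv]
            constructor
            · rintro (h | h)
              · omega
              · exact h.2
            · exact fun h => Or.inr ⟨by omega, h⟩
          have hz' : ¬ actv (insert e (rmv C2 (.mv c (c + 1)))) (.mv c2 d2) := by
            intro ⟨a, b, e⟩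
            rw [mem _ (by omega)] at a
            rw [mem _ (by omega)] at e
            exact hz ⟨a, b, e⟩
          obtain ⟨rfl, rfl⟩ := keep_of_step s2 hz'
          refine ⟨rfl, ?_, rfl⟩
          rw [ff_congr (mem c2 (by omega)), ff_congr (mem d2 (by omega))]
        · obtain ⟨rfl, rfl⟩ := keep_of_step s1 hx
          obtain ⟨rfl, rfl⟩ := keep_of_step s4 hx
          obtain ⟨rfl, rfl⟩ := keep_of_step s2 hz
          exact ⟨rfl, rfl, rfl⟩

/-- triples of moves run through a row -/
structure Run (r : ℤ) (σ : ℕ → ℤ) (C : Finset ℕ) (m1 m2 m3 : Mv) (C3 : Finset ℕ)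
    (o1 o2 o3 : Mv) : Prop where
  v1 : VMv σ m1
  v2 : VMv (app m1 σ) m2
  v3 : VMv (app m2 (app m1 σ)) m3
  ex : ∃ C1 C2, Step r σ C m1 C1 o1 ∧ Step r (app m1 σ) C1 m2 C2 o2 ∧
    Step r (app m2 (app m1 σ)) C2 m3 C3 o3

/-- `(y,z,x) ~ (y,x,z)` -/
def RelI (a1 a2 a3 b1 b2 b3 : Mv) : Prop :=
  b1 = a1 ∧ b2 = a3 ∧ b3 = a2 ∧ LE' a1 a2 ∧ LT' a3 a1


def RelII (a1 a2 a3 b1 b2 b3 : Mv) : Prop :=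
  b1 = a2 ∧ b2 = a1 ∧ b3 = a3 ∧ LE' a1 a3 ∧ LT' a3 a2

def RelB (a1 a2 a3 b1 b2 b3 : Mv) : Prop :=
  ∃ α β γ δ, α < β ∧ β < γ ∧ γ < δ ∧ a1 = .mv α γ ∧ a2 = .mv γ δ ∧ a3 = .mv β γ ∧
    b1 = .mv β γ ∧ b2 = .mv α β ∧ b3 = .mv β δ

theorem sep_i {σ : ℕ → ℤ} {x y z : Mv} (hv : VMv σ y) (h1 : LE' y z) (h2 : LT' x y) :
    SEP x z := by
  cases x <;> cases y <;> cases z <;> simp_all [LE', LT', SEP, VMv]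
  omega

theorem row_i {r : ℤ} {σ : ℕ → ℤ} {C C3 D3 : Finset ℕ} {a1 a2 a3 b1 b2 b3 o1 o2 o3 p1 p2 p3 : Mv}
    (hV : Val r σ C) (hA : Run r σ C a1 a2 a3 C3 o1 o2 o3) (hB : Run r σ C b1 b2 b3 D3 p1 p2 p3)
    (h : RelI a1 a2 a3 b1 b2 b3) : C3 = D3 ∧ RelI o1 o2 o3 p1 p2 p3 := by
  obtain ⟨rfl, rfl, rfl, hle, hlt⟩ := h
  obtain ⟨v1, v2, v3, C1, C2, s1, s2, s3⟩ := hA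
  obtain ⟨w1, w2, w3, D1, D2, t1, t2, t3⟩ := hB
  obtain ⟨rfl, rfl⟩ := step_det s1 t1
  obtain ⟨q1, q2, q3⟩ := step_main hV v1 s1
  have L1 := le_lemma hV v1 s1 s2 hle
  have L2 := lt_lemma hV v1 s1 w2 t2 hlt
  rcases comm_lemma q2 w2 v2 t2 t3 s2 s3 (sep_i v1 hle hlt) with ⟨c, d, rfl, hd, rfl, hz, hcz⟩ | h
  · exfalso
    obtain ⟨rfl, rfl⟩ := keep_of_step t2 (fun h => hd h.2.2)
    rw [ff_out hd] at L2
    cases o1 with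
    | nil => exact L1
    | emp => exact L1
    | mv c1 d1 =>
      have l1 : d1 ≤ d := L1
      have l2 : d + 1 ≤ c1 := L2
      have := q3.1
      omega
  · obtain ⟨rfl, rfl, rfl⟩ := h
    exact ⟨rfl, rfl, rfl, rfl, L1, L2⟩

theorem sep_ii {σ : ℕ → ℤ} {x y z : Mv} (hv : VMv σ y) (h1 : LE' x y) (h2 : LT' y z) :
    SEP x z := by
  cases x <;> cases y <;> cases z <;> simp_all [LE', LT', SEP, VMv]
  omega

def isMv : Mv → Prop
  | .mv _ _ => True
  | _ => False

/-- the last positive exit label at or before a column is unique -/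
theorem last_eq {f : ℕ → ℤ} {b e e' : ℕ} (h1 : e ≤ b) (h2 : 0 < f e)
    (h3 : ∀ x, e < x → x ≤ b → f x ≤ 0) (h1' : e' ≤ b) (h2' : 0 < f e')
    (h3' : ∀ x, e' < x → x ≤ b → f x ≤ 0) : e = e' := by
  rcases lt_trichotomy e e' with h | h | h
  · have := h3 _ h h1'; omega
  · exact h
  · have := h3' _ h h1; omega

theorem row_ii {r : ℤ} {σ : ℕ → ℤ} {C C3 D3 : Finset ℕ} {a1 a2 a3 b1 b2 b3 o1 o2 o3 p1 p2 p3 : Mv}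
    (hV : Val r σ C) (hA : Run r σ C a1 a2 a3 C3 o1 o2 o3) (hB : Run r σ C b1 b2 b3 D3 p1 p2 p3)
    (h : RelII a1 a2 a3 b1 b2 b3) : C3 = D3 ∧ (RelII o1 o2 o3 p1 p2 p3 ∨
      (isMv a1 ∧ isMv a3 ∧ actv C a2 ∧ (RelI o1 o2 o3 p1 p2 p3 ∨ RelB o1 o2 o3 p1 p2 p3))) := by
  obtain ⟨rfl, rfl, rfl, hle, hlt⟩ := h
  obtain ⟨v1, v2, v3, C1, C2, s1, s2, s3⟩ := hA
  obtain ⟨w1, w2, w3, D1, D2, t1, t2, t3⟩ := hB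
  have VA := step_main hV v1 s1
  have VB := step_main hV w1 t1
  rcases comm_lemma hV v1 w1 s1 s2 t1 t2 (sep_ii v3 hle hlt) with ⟨c, d, rfl, hd, rfl, hz, hcz⟩ | h
  · obtain ⟨rfl, rfl⟩ := keep_of_step s1 (fun h => hd h.2.2)
    rw [ff_out hd] at *
    obtain ⟨e, rfl, he, e1, e2, e3⟩ := act_of_step t1 hz
    obtain ⟨rfl, -⟩ : d = e ∧ d + 1 = e + 1 := by simpa using he
    obtain ⟨k1, k2, k3, k4⟩ := act_struct hV hz e1 e2 e3
    have hd1 := next_out hV hd v1.2.2.1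
    have hcd := v1.1
    have ofd := out_ffd hV v1.2.2.1
    have hkx : ¬ actv C1 (.mv c d) := fun h => hd h.2.2
    have ofc := out_ffc hV v1 hkx
    rw [ff_out hd] at ofd
    have hfc : ff C1 c ≤ d := (ff_le C1 c).trans hcd
    have hsc := v1.2.1
    have hsd := v1.2.2.1
    -- identify y
    have hy : b3 = .mv d (d + 1) := by
      cases b3 with
      | nil => cases b1 <;> simp [LT', actv] at hlt hz
      | emp => cases b1 <;> simp [LT', actv] at hlt hz
      | mv cy dy =>
        have h1 : d ≤ cy := hle
        have hv3 : cy < dy := v3.1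
        have hcut : cut b1 dy := by
          cases b1 with
          | nil => exact hz
          | emp => trivial
          | mv c2 d2 => exact hlt
        have key : ∀ x, d < x → x < dy → app b1 (app (.mv c d) σ) x ≤ 0 := by
          intro x hx hx'
          rw [cut_app (cut_le (by omega) hcut) v2, app_mv, if_neg (by omega), if_neg (by omega)]
          exact k4 x (by omega) (cut_le (by omega) hcut)
        have hcy : cy = d := by
          by_contra hne
          have := key cy (by omega) hv3
          have := v3.2.1
          omega
        subst hcy
        have : dy = cy + 1 := by
          by_contra hne
          have := key (cy + 1) (by omega) (by omega)
          have := v3.2.2.2 (cy + 1) (by omega) (by omega)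
          have := v3.2.1
          omega
        rw [this]
    subst hy
    obtain ⟨A1, A2, A3⟩ := VA
    obtain ⟨B1, B2, B3⟩ := VB
    -- z after x
    have h2 : Step r (app (.mv c d) σ) C1 b1 (insert (d + 1) (rmv C1 b1))
        (.mv (d + 1) (d + 1 + 1)) := by
      apply step_of_act hz hcz
      · rw [A1, app_mv, if_neg (by omega), if_pos rfl, ofc]; exact hsc
      · intro x hx hx'
        rw [A1, app_mv, if_neg (by omega), if_neg (by omega)]
        exact e3 x (by omega) hx'
    obtain ⟨rfl, rfl⟩ := step_det s2 h2
    have mem1 : ∀ x, x ≤ d + 1 → (x ∈ insert (d + 1) (rmv C1 b1) ↔ x = d + 1 ∨ x ∈ C1) :=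
      fun x hx => mem_ins_rmv' hz hcz (cut_le hx hcz)
    have mem2 : ∀ x, x ≤ d + 1 → (x ∈ insert d (rmv C1 b1) ↔ x = d ∨ x ∈ C1) :=
      fun x hx => mem_ins_rmv' hz e1 (cut_le hx hcz)
    have A' := step_main A2 v2 s2
    have B' := step_main B2 w2 t2
    have hrd : d ∉ rmv C1 b1 := by
      cases b1 <;> simp [rmv, hd]
    have hrd1 : d + 1 ∉ rmv C1 b1 := by
      cases b1 <;> simp [rmv, hd1]
    -- y bumps in the first order
    have ha3 : actv (insert (d + 1) (rmv C1 b1)) (.mv d (d + 1)) := by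
      refine ⟨?_, rfl, ?_⟩
      · rw [mem1 _ (by omega)]; simp [hd]
      · simp
    obtain ⟨g, rfl, rfl, g1, g2, g3⟩ := act_of_step s3 ha3
    have g1' : g ≤ d := g1
    have o2 : ∀ x, x ≤ d → outR r (app b1 (app (.mv c d) σ)) (insert (d + 1) (rmv C1 b1)) x =
        if x = ff C1 c then σ d else outR r σ C1 x := by
      intro x hx
      rw [A'.1, app_mv, if_neg (by omega), if_neg (by omega), A1, app_mv, ofd]
      split_ifs <;> first | rfl | omega
    rw [o2 _ g1'] at g2
    have g3' : ∀ x, g < x → x ≤ d → (if x = ff C1 c then σ d else outR r σ C1 x) ≤ 0 := by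
      intro x hx hx'
      rw [← o2 _ hx']
      exact g3 x hx hx'
    have hB1 : ∀ x, x < d → outR r (app b1 σ) (insert d (rmv C1 b1)) x = outR r σ C1 x := by
      intro x hx
      rw [B1, app_mv, if_neg (by omega), if_neg (by omega)]
    by_cases hS : ff C1 c = d
    · -- S1
      have hcC : c ∉ C1 := by
        intro h
        rw [ff_in h] at hS; omega
      have hdc : d = c + 1 := by rw [ff_out hcC] at hS; exact hS.symm
      have hgd : g ≠ d := by
        rintro rfl
        rw [if_pos hS.symm] at g2; omega
      have hx2 : actv (insert d (rmv C1 b1)) (.mv c d) := by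
        refine ⟨?_, hdc, by simp⟩
        rw [mem2 _ (by omega)]
        rintro (h | h)
        · omega
        · exact hcC h
      obtain ⟨g', rfl, rfl, f1, f2, f3⟩ := act_of_step t2 hx2
      have f1' : g' ≤ c := f1
      have hgg : g = g' := by
        refine last_eq (f := outR r σ C1) (b := c) (by omega) ?_ ?_ f1' ?_ ?_
        · rwa [if_neg (by omega)] at g2
        · intro x hx hx'
          have := g3' x hx (by omega)
          rwa [if_neg (by omega)] at this
        · rwa [hB1 _ (by omega)] at f2
        · intro x hx hx'
          have := f3 x hx hx'
          rwa [hB1 _ (by omega)] at this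
      subst hgg
      have hd3 : d + 1 ∉ insert g (rmv (insert d (rmv C1 b1)) (.mv c d)) := by
        rw [mem_ins_rmv, mem2 _ le_rfl]
        simp [hd1]; omega
      have hd4 : d ∉ insert g (rmv (insert d (rmv C1 b1)) (.mv c d)) := by
        rw [mem_ins_rmv]
        simp; omega
      obtain ⟨rfl, rfl⟩ := keep_of_step t3 (fun h => hd3 h.2.2)
      rw [ff_out hd3, ff_out hd4]
      refine ⟨?_, Or.inr ⟨trivial, trivial, hz, Or.inl ⟨by rw [hS], rfl, rfl, ?_, ?_⟩⟩⟩
      · show insert g ((insert (d + 1) (rmv C1 b1)).erase (d + 1)) =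
          insert g ((insert d (rmv C1 b1)).erase d)
        rw [Finset.erase_insert hrd, Finset.erase_insert hrd1]
      · exact le_rfl
      · show g + 1 ≤ ff C1 c
        omega
    · -- S2
      have hgd : g = d := by
        by_contra hne
        have := g3' d (by omega) le_rfl
        rw [if_neg (fun h => hS h.symm)] at this
        omega
      subst hgd
      have hcmem : c ∈ insert g (rmv C1 b1) ↔ c ∈ C1 := by
        rw [mem2 _ (by omega)]
        constructor
        · rintro (h | h)
          · omega
          · exact h
        · exact Or.inr
      have hx2 : ¬ actv (insert g (rmv C1 b1)) (.mv c g) := by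
        rintro ⟨h1, h2, h3⟩
        rw [hcmem] at h1
        rw [ff_out h1] at hS
        omega
      obtain ⟨rfl, rfl⟩ := keep_of_step t2 hx2
      have hgm : g ∈ insert g (rmv C1 b1) := by simp
      have hg1 : g + 1 ∉ insert g (rmv C1 b1) := by
        rw [mem2 _ le_rfl]; simp [hd1]
      obtain ⟨rfl, rfl⟩ := keep_of_step t3 (fun h => hg1 h.2.2)
      rw [ff_in hgm, ff_out hg1, ff_congr hcmem]
      refine ⟨?_, Or.inr ⟨trivial, trivial, hz, Or.inr
        ⟨ff C1 c, g, g + 1, g + 1 + 1, by omega, by omega, by omega, rfl, rfl, rfl, rfl, rfl, rfl⟩⟩⟩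
      show insert g ((insert (g + 1) (rmv C1 b1)).erase (g + 1)) = insert g (rmv C1 b1)
      rw [Finset.erase_insert hrd1]
  · obtain ⟨rfl, rfl, rfl⟩ := h
    have L1 := le_lemma VB.2.1 w2 t2 t3 hle
    have L2 := lt_lemma VA.2.1 v2 s2 v3 s3 hlt
    have e : app b2 (app b1 σ) = app b1 (app b2 σ) := by
      have hs := sep_ii v3 hle hlt
      cases b2 <;> cases b1 <;> simp only [SEP] at hs <;> try rfl
      funext x
      have := v1.1
      have := w1.1
      simp only [app]
      split_ifs <;> first | rfl | omega
    rw [e] at t3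
    obtain ⟨rfl, rfl⟩ := step_det s3 t3
    exact ⟨rfl, Or.inl ⟨rfl, rfl, rfl, L1, L2⟩⟩

theorem row_B {r : ℤ} {σ : ℕ → ℤ} {C C3 D3 : Finset ℕ} {a1 a2 a3 b1 b2 b3 o1 o2 o3 p1 p2 p3 : Mv}
    (hV : Val r σ C) (hA : Run r σ C a1 a2 a3 C3 o1 o2 o3) (hB : Run r σ C b1 b2 b3 D3 p1 p2 p3)
    (h : RelB a1 a2 a3 b1 b2 b3) : C3 = D3 ∧
      (RelI o1 o2 o3 p1 p2 p3 ∨ RelB o1 o2 o3 p1 p2 p3) := by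
  obtain ⟨α, β, γ, δ, hab, hbc, hcd, rfl, rfl, rfl, rfl, rfl, rfl⟩ := h
  obtain ⟨v1, v2, v3, C1, C2, s1, s2, s3⟩ := hA
  obtain ⟨w1, w2, w3, D1, D2, t1, t2, t3⟩ := hB
  have VA := step_main hV v1 s1
  have VB := step_main hV w1 t1
  have n1 : ¬ actv C (.mv α γ) := fun h => by have := h.2.1; omega
  obtain ⟨rfl, rfl⟩ := keep_of_step s1 n1
  have n2 : ¬ actv C1 (.mv γ δ) := by
    rintro ⟨h1, h2, h3⟩
    subst h2
    exact next_out hV h1 v1.2.2.1 h3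
  obtain ⟨rfl, rfl⟩ := keep_of_step s2 n2
  have VA2 := step_main VA.2.1 v2 s2
  have VB2 := step_main VB.2.1 w2 t2
  have kn := fun h => keep_next hV v1 n1 h
  by_cases ha : actv C2 (.mv β γ)
  · obtain ⟨g, rfl, rfl, g1, g2, g3⟩ := act_of_step s3 ha
    obtain ⟨e, rfl, rfl, e1, e2, e3⟩ := act_of_step t1 ha
    obtain ⟨x1, rfl, x3⟩ := ha
    have e1' : e ≤ β := e1
    have g1' : g ≤ β := g1
    have hfa : ff C2 α ≤ β := (ff_le C2 α).trans hab
    have ofa := out_ffc hV v1 n1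
    have ofd := out_ffd hV v1.2.2.1
    have p1 := v1.2.1
    have p2 := v1.2.2.1
    have hob : 0 < outR r σ C2 β := by
      rcases hfa.eq_or_lt with h | h
      · rw [← h, ofa]; exact p1
      · rw [out_out x1]
        have := hh_gt hV v1 β h (by omega)
        omega
    have heb : e = β := by
      by_contra hne
      have := e3 β (by omega) le_rfl
      omega
    subst heb
    rw [ff_in x3] at *
    have hd := ff_ge C2 δ
    have o2 : ∀ x, x ≤ e → outR r (app (.mv (e + 1) δ) (app (.mv α (e + 1)) σ)) C2 x =
        if x = ff C2 α then σ (e + 1) else outR r σ C2 x := by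
      intro x hx
      rw [VA2.1, app_mv, if_neg (by omega), if_neg (by omega), VA.1, app_mv, ofd]
      split_ifs <;> first | rfl | omega
    rw [o2 _ g1'] at g2
    have g3' : ∀ x, g < x → x ≤ e → (if x = ff C2 α then σ (e + 1) else outR r σ C2 x) ≤ 0 := by
      intro x hx hx'
      rw [← o2 _ hx']
      exact g3 x hx hx'
    have hB1 : ∀ x, x < e → outR r (app (.mv e (e + 1)) σ) (insert e (rmv C2 (.mv e (e + 1)))) x
        = outR r σ C2 x := by
      intro x hx
      rw [VB.1, app_mv, if_neg (by omega), if_neg (by omega)]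
    have mem : ∀ x, x ≠ e → x ≠ e + 1 →
        (x ∈ insert e (rmv C2 (.mv e (e + 1))) ↔ x ∈ C2) := by
      intro x h1 h2
      rw [mem_ins_rmv]
      simp [h1, h2]
    by_cases hS : ff C2 α = e
    · have hac : α ∉ C2 := by
        intro h
        rw [ff_in h] at hS; omega
      have hea : e = α + 1 := by rw [ff_out hac] at hS; exact hS.symm
      have hx2 : actv (insert e (rmv C2 (.mv e (e + 1)))) (.mv α e) := by
        refine ⟨?_, hea, by simp⟩
        rw [mem _ (by omega) (by omega)]
        exact hac
      obtain ⟨g', rfl, rfl, f1, f2, f3⟩ := act_of_step t2 hx2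
      have f1' : g' ≤ α := f1
      have hge : g ≠ e := by
        rintro rfl
        rw [if_pos hS.symm] at g2; omega
      have hgg : g = g' := by
        refine last_eq (f := outR r σ C2) (b := α) (by omega) ?_ ?_ f1' ?_ ?_
        · rwa [if_neg (by omega)] at g2
        · intro x hx hx'
          have := g3' x hx (by omega)
          rwa [if_neg (by omega)] at this
        · rwa [hB1 _ (by omega)] at f2
        · intro x hx hx'
          have := f3 x hx hx'
          rwa [hB1 _ (by omega)] at this
      subst hgg
      have hC : insert g (rmv (insert e (rmv C2 (.mv e (e + 1)))) (.mv α e)) =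
          insert g (rmv C2 (.mv e (e + 1))) := by
        simp only [rmv]
        rw [Finset.erase_insert]
        simp [x1]
      rw [hC] at t3
      have hk : ¬ actv (insert g (rmv C2 (.mv e (e + 1)))) (.mv e δ) := by
        intro h; have := h.2.1; omega
      obtain ⟨rfl, rfl⟩ := keep_of_step t3 hk
      have q1 : e ∉ insert g (rmv C2 (.mv e (e + 1))) := by
        rw [mem_ins_rmv]; simp [x1]; omega
      have q2 : δ ∈ insert g (rmv C2 (.mv e (e + 1))) ↔ δ ∈ C2 := by
        rw [mem_ins_rmv]
        have i1 : δ ≠ g := by omega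
        have i2 : δ ≠ e + 1 := by omega
        simp [i1, i2]
      rw [ff_out q1, ff_congr q2]
      refine ⟨rfl, Or.inl ⟨by rw [hS], rfl, rfl, le_rfl, ?_⟩⟩
      show g + 1 ≤ ff C2 α
      omega
    · have hge : g = e := by
        by_contra hne
        have := g3' e (by omega) le_rfl
        rw [if_neg (fun h => hS h.symm)] at this
        omega
      subst hge
      have hx2 : ¬ actv (insert g (rmv C2 (.mv g (g + 1)))) (.mv α g) := by
        rintro ⟨h1, h2, h3⟩
        rw [mem _ (by omega) (by omega)] at h1
        rw [ff_out h1] at hS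
        omega
      obtain ⟨rfl, rfl⟩ := keep_of_step t2 hx2
      have hk : ¬ actv (insert g (rmv C2 (.mv g (g + 1)))) (.mv g δ) := by
        intro h; have := h.2.1; omega
      obtain ⟨rfl, rfl⟩ := keep_of_step t3 hk
      have hgm : g ∈ insert g (rmv C2 (.mv g (g + 1))) := by simp
      rw [ff_in hgm, ff_congr (mem α (by omega) (by omega)), ff_congr (mem δ (by omega) (by omega))]
      exact ⟨rfl, Or.inr ⟨ff C2 α, g, g + 1, ff C2 δ, by omega, by omega, by omega,
        rfl, rfl, rfl, rfl, rfl, rfl⟩⟩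
  · obtain ⟨rfl, rfl⟩ := keep_of_step s3 ha
    obtain ⟨rfl, rfl⟩ := keep_of_step t1 ha
    have hb : ¬ actv D1 (.mv α β) := by
      rintro ⟨h1, h2, h3⟩
      subst h2
      exact kn h1 h3
    obtain ⟨rfl, rfl⟩ := keep_of_step t2 hb
    have hc : ¬ actv D2 (.mv β δ) := by
      intro h; have := h.2.1; omega
    obtain ⟨rfl, rfl⟩ := keep_of_step t3 hc
    exact ⟨rfl, Or.inr ⟨_, _, _, _, keep_lt hab hb, keep_lt hbc ha, keep_lt hcd n2,
      rfl, rfl, rfl, rfl, rfl, rfl⟩⟩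

def lv (D : ℕ → Finset ℕ) : ℕ → ℕ → ℤ
  | 0 => fun c => -(c : ℤ)
  | s + 1 => outR ((s + 1 : ℕ) : ℤ) (lv D s) (D (s + 1))

def GoodD (n : ℕ) (D : ℕ → Finset ℕ) : Prop :=
  ∀ s, s < n → Val ((s + 1 : ℕ) : ℤ) (lv D s) (D (s + 1))

def inp (k : ℕ) (M : ℕ → Mv) (s : ℕ) : Mv := if s + 1 = k then .emp else M s

structure InsAb (n k : ℕ) (D D' : ℕ → Finset ℕ) (M : ℕ → Mv) : Prop where
  zero : M 0 = .nil
  step : ∀ s, s < n → Step ((s + 1 : ℕ) : ℤ) (lv D s) (D (s + 1)) (inp k M s) (D' (s + 1)) (M (s + 1))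

theorem step_nil {r : ℤ} {σ : ℕ → ℤ} {C C' : Finset ℕ} {o : Mv} (h : Step r σ C .nil C' o) :
    o = .nil := by cases h; rfl

theorem step_isMv {r : ℤ} {σ : ℕ → ℤ} {C C' : Finset ℕ} {m o : Mv} (h : Step r σ C m C' o)
    (hm : m = .emp ∨ isMv m) : isMv o := by
  cases h with
  | nil => rcases hm with h | h <;> cases h
  | emp _ _ _ => trivial
  | bump _ _ _ _ _ _ _ => trivial
  | keep _ _ _ => trivial

theorem ab_nil {n k : ℕ} {D D' : ℕ → Finset ℕ} {M : ℕ → Mv} (h : InsAb n k D D' M) :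
    ∀ s, s ≤ n → s < k → M s = .nil := by
  intro s
  induction s with
  | zero => intro _ _; exact h.zero
  | succ s ih =>
    intro hs hk
    have := h.step s (by omega)
    rw [inp, if_neg (by omega), ih (by omega) (by omega)] at this
    exact step_nil this

theorem ab_isMv {n k : ℕ} {D D' : ℕ → Finset ℕ} {M : ℕ → Mv} (h : InsAb n k D D' M) (hk : 1 ≤ k) :
    ∀ s, s ≤ n → k ≤ s → isMv (M s) := by
  intro s
  induction s with
  | zero => intro _ _; omega
  | succ s ih =>
    intro hs hk
    refine step_isMv (h.step s (by omega)) ?_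
    unfold inp
    split_ifs with hks
    · exact Or.inl rfl
    · exact Or.inr (ih (by omega) (by omega))

theorem vmv_inp {σ : ℕ → ℤ} {k s : ℕ} {M : ℕ → Mv} (h : VMv σ (M s)) : VMv σ (inp k M s) := by
  unfold inp; split_ifs
  · trivial
  · exact h

theorem app_inp {n k s : ℕ} {D D' : ℕ → Finset ℕ} {M : ℕ → Mv} (h : InsAb n k D D' M)
    (hs : s ≤ n) (σ : ℕ → ℤ) : app (inp k M s) σ = app (M s) σ := by
  unfold inp; split_ifs with hk
  · rw [ab_nil h s hs (by omega)]; rfl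
  · rfl

theorem ab_main {n k : ℕ} {D D' : ℕ → Finset ℕ} {M : ℕ → Mv} (hG : GoodD n D)
    (h : InsAb n k D D' M) : ∀ s, s ≤ n → lv D' s = app (M s) (lv D s) ∧ VMv (lv D s) (M s) ∧
      (s < n → Val ((s + 1 : ℕ) : ℤ) (lv D' s) (D' (s + 1))) := by
  have key : ∀ s, s < n → lv D' s = app (M s) (lv D s) → VMv (lv D s) (M s) →
      lv D' (s + 1) = app (M (s + 1)) (lv D (s + 1)) ∧ VMv (lv D (s + 1)) (M (s + 1)) ∧
      Val ((s + 1 : ℕ) : ℤ) (lv D' s) (D' (s + 1)) := by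
    intro s hs i1 i2
    obtain ⟨a1, a2, a3⟩ := step_main (hG s hs) (vmv_inp i2) (h.step s hs)
    rw [app_inp h hs.le, ← i1] at a1 a2
    exact ⟨a1, a3, a2⟩
  have main : ∀ s, s ≤ n → lv D' s = app (M s) (lv D s) ∧ VMv (lv D s) (M s) := by
    intro s
    induction s with
    | zero => intro _; rw [h.zero]; exact ⟨rfl, trivial⟩
    | succ s ih =>
      intro hs
      obtain ⟨i1, i2⟩ := ih (by omega)
      obtain ⟨k1, k2, k3⟩ := key s (by omega) i1 i2
      exact ⟨k1, k2⟩
  intro s hs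
  exact ⟨(main s hs).1, (main s hs).2, fun hs' => (key s hs' (main s hs).1 (main s hs).2).2.2⟩

theorem ab_good {n k : ℕ} {D D' : ℕ → Finset ℕ} {M : ℕ → Mv} (hG : GoodD n D)
    (h : InsAb n k D D' M) : GoodD n D' := fun s hs => (ab_main hG h s hs.le).2.2 hs

theorem lv_nonpos (D : ℕ → Finset ℕ) (s : ℕ) : ∃ N, ∀ x, N ≤ x → lv D s x ≤ 0 := by
  induction s with
  | zero => exact ⟨0, fun x _ => by simp [lv]⟩
  | succ s ih =>
    obtain ⟨N, hN⟩ := ih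
    refine ⟨N + (D (s + 1)).sup id + 2, fun x hx => ?_⟩
    have hC : ∀ y, N + (D (s + 1)).sup id + 1 ≤ y → y ∉ D (s + 1) := by
      intro y hy h
      have := Finset.le_sup (f := id) h
      simp only [id] at this; omega
    show outR _ _ _ x ≤ 0
    obtain ⟨y, rfl⟩ : ∃ y, x = y + 1 := ⟨x - 1, by omega⟩
    rw [out_out (hC _ (by omega)), hh_out (hC _ (by omega))]
    exact hN _ (by omega)

def stepF (r : ℤ) (σ : ℕ → ℤ) (C : Finset ℕ) (m : Mv) : Finset ℕ × Mv :=
  if h : ∃ p : Finset ℕ × Mv, Step r σ C m p.1 p.2 then h.choose else (∅, .nil)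

def seqM (k : ℕ) (D : ℕ → Finset ℕ) : ℕ → Finset ℕ × Mv
  | 0 => (∅, .nil)
  | s + 1 => stepF ((s + 1 : ℕ) : ℤ) (lv D s) (D (s + 1))
      (if s + 1 = k then .emp else (seqM k D s).2)

theorem ab_exists {n : ℕ} (k : ℕ) {D : ℕ → Finset ℕ} (hG : GoodD n D) :
    InsAb n k D (fun s => (seqM k D s).1) (fun s => (seqM k D s).2) := by
  refine ⟨rfl, fun s hs => ?_⟩
  obtain ⟨C', o, h⟩ := step_exists (hG s hs) (lv_nonpos D s)
    (if s + 1 = k then .emp else (seqM k D s).2)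
  have hex : ∃ p : Finset ℕ × Mv, Step ((s + 1 : ℕ) : ℤ) (lv D s) (D (s + 1))
      (if s + 1 = k then .emp else (seqM k D s).2) p.1 p.2 := ⟨(C', o), h⟩
  have := hex.choose_spec
  simp only [inp, seqM, stepF, dif_pos hex]
  exact this

theorem mk_run {n a b c s : ℕ} {D D1 D2 D3 : ℕ → Finset ℕ} {M1 M2 M3 : ℕ → Mv} (hG : GoodD n D)
    (h1 : InsAb n a D D1 M1) (h2 : InsAb n b D1 D2 M2) (h3 : InsAb n c D2 D3 M3) (hs : s < n) :
    Run ((s + 1 : ℕ) : ℤ) (lv D s) (D (s + 1)) (inp a M1 s) (inp b M2 s) (inp c M3 s)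
      (D3 (s + 1)) (M1 (s + 1)) (M2 (s + 1)) (M3 (s + 1)) := by
  have g1 := ab_good hG h1
  have g2 := ab_good g1 h2
  have m1 := ab_main hG h1 s hs.le
  have m2 := ab_main g1 h2 s hs.le
  have m3 := ab_main g2 h3 s hs.le
  have e1 : app (inp a M1 s) (lv D s) = lv D1 s := by rw [app_inp h1 hs.le, m1.1]
  have e2 : app (inp b M2 s) (lv D1 s) = lv D2 s := by rw [app_inp h2 hs.le, m2.1]
  refine ⟨vmv_inp m1.2.1, ?_, ?_, D1 (s + 1), D2 (s + 1), h1.step s hs, ?_, ?_⟩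
  · rw [e1]; exact vmv_inp m2.2.1
  · rw [e1, e2]; exact vmv_inp m3.2.1
  · rw [e1]; exact h2.step s hs
  · rw [e1, e2]; exact h3.step s hs

theorem le_inp {a b s : ℕ} {M N : ℕ → Mv} (h : LE' (M s) (N s)) (hab : a ≤ b)
    (ha : a ≤ s → isMv (M s)) (hb : s < b → N s = .nil) :
    LE' (inp a M s) (inp b N s) := by
  unfold inp
  split_ifs with h1 h2 h2
  · trivial
  · rw [hb (by omega)]; trivial
  · have := ha (by omega)
    generalize M s = m at *
    cases m <;> trivial
  · exact h

theorem lt_inp {a b s : ℕ} {M N : ℕ → Mv} (h : LT' (M s) (N s)) (hab : a < b)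
    (ha : a ≤ s → isMv (M s)) (hb : s < b → N s = .nil) :
    LT' (inp a M s) (inp b N s) := by
  unfold inp
  split_ifs with h1 h2 h2
  · omega
  · rw [hb (by omega)]; trivial
  · have := ha (by omega)
    generalize M s = m at *
    cases m <;> trivial
  · exact h

theorem ab_knuth_i {n x y z : ℕ} (hx : 1 ≤ x) (hxy : x < y) (hyz : y ≤ z)
    {D D1 D2 D3 E1 E2 E3 : ℕ → Finset ℕ} {M1 M2 M3 N1 N2 N3 : ℕ → Mv} (hG : GoodD n D)
    (h1 : InsAb n y D D1 M1) (h2 : InsAb n z D1 D2 M2) (h3 : InsAb n x D2 D3 M3)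
    (k1 : InsAb n y D E1 N1) (k2 : InsAb n x E1 E2 N2) (k3 : InsAb n z E2 E3 N3) :
    ∀ s, s < n → D3 (s + 1) = E3 (s + 1) := by
  have key : ∀ s, s < n → RelI (M1 s) (M2 s) (M3 s) (N1 s) (N2 s) (N3 s) →
      D3 (s + 1) = E3 (s + 1) ∧ RelI (M1 (s + 1)) (M2 (s + 1)) (M3 (s + 1)) (N1 (s + 1))
        (N2 (s + 1)) (N3 (s + 1)) := by
    intro s hs hr
    refine row_i (hG s hs) (mk_run hG h1 h2 h3 hs) (mk_run hG k1 k2 k3 hs) ?_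
    obtain ⟨a, b, c, d, e⟩ := hr
    refine ⟨by simp [inp, a], by simp [inp, b], by simp [inp, c], ?_, ?_⟩
    · exact le_inp d hyz (ab_isMv h1 (by omega) s hs.le) (ab_nil h2 s hs.le)
    · exact lt_inp e hxy (ab_isMv h3 (by omega) s hs.le) (ab_nil h1 s hs.le)
  have main : ∀ s, s ≤ n → RelI (M1 s) (M2 s) (M3 s) (N1 s) (N2 s) (N3 s) := by
    intro s
    induction s with
    | zero =>
      intro _
      rw [h1.zero, h2.zero, h3.zero, k1.zero, k2.zero, k3.zero]
      exact ⟨rfl, rfl, rfl, trivial, trivial⟩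
    | succ s ih => intro hs; exact (key s (by omega) (ih (by omega))).2
  exact fun s hs => (key s hs (main s hs.le)).1

theorem ab_knuth_ii {n x y z : ℕ} (hx : 1 ≤ x) (hxy : x ≤ y) (hyz : y < z)
    {D D1 D2 D3 E1 E2 E3 : ℕ → Finset ℕ} {M1 M2 M3 N1 N2 N3 : ℕ → Mv} (hG : GoodD n D)
    (h1 : InsAb n x D D1 M1) (h2 : InsAb n z D1 D2 M2) (h3 : InsAb n y D2 D3 M3)
    (k1 : InsAb n z D E1 N1) (k2 : InsAb n x E1 E2 N2) (k3 : InsAb n y E2 E3 N3) :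
    ∀ s, s < n → D3 (s + 1) = E3 (s + 1) := by
  let Q : ℕ → Prop := fun s => RelII (M1 s) (M2 s) (M3 s) (N1 s) (N2 s) (N3 s) ∨
    (z ≤ s ∧ (RelI (M1 s) (M2 s) (M3 s) (N1 s) (N2 s) (N3 s) ∨
      RelB (M1 s) (M2 s) (M3 s) (N1 s) (N2 s) (N3 s)))
  have key : ∀ s, s < n → Q s → D3 (s + 1) = E3 (s + 1) ∧ Q (s + 1) := by
    intro s hs hr
    have rA := mk_run hG h1 h2 h3 hs
    have rB := mk_run hG k1 k2 k3 hs
    rcases hr with ⟨a, b, c, d, e⟩ | ⟨hz, hr⟩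
    · have := row_ii (hG s hs) rA rB
        ⟨by simp [inp, a], by simp [inp, b], by simp [inp, c],
         le_inp d hxy (ab_isMv h1 (by omega) s hs.le) (ab_nil h3 s hs.le),
         lt_inp e hyz (ab_isMv h3 (by omega) s hs.le) (ab_nil h2 s hs.le)⟩
      refine ⟨this.1, ?_⟩
      rcases this.2 with h | ⟨i1, i2, i3, i4⟩
      · exact Or.inl h
      · refine Or.inr ⟨?_, i4⟩
        by_contra hcon
        have : inp z M2 s = .nil := by
          rw [inp, if_neg (by omega), ab_nil h2 s hs.le (by omega)]
        rw [this] at i3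
        exact i3
    · have q : ∀ k M, k ≤ z → inp k M s = M s := by
        intro k M hk
        rw [inp, if_neg (by omega)]
      rw [q x _ (by omega), q y _ (by omega), q z _ le_rfl] at rA rB
      rcases hr with hr | hr
      · have := row_i (hG s hs) rA rB hr
        exact ⟨this.1, Or.inr ⟨by omega, Or.inl this.2⟩⟩
      · have := row_B (hG s hs) rA rB hr
        exact ⟨this.1, Or.inr ⟨by omega, this.2⟩⟩
  have main : ∀ s, s ≤ n → Q s := by
    intro s
    induction s with
    | zero =>
      intro _
      left
      rw [h1.zero, h2.zero, h3.zero, k1.zero, k2.zero, k3.zero]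
      exact ⟨rfl, rfl, rfl, trivial, trivial⟩
    | succ s ih => intro hs; exact (key s (by omega) (ih (by omega))).2
  exact fun s hs => (key s hs (main s hs.le)).1

def Inv (w : Equiv.Perm ℤ) : Set (ℤ × ℤ) := {p | p.1 < p.2 ∧ w p.2 < w p.1}

theorem sT_lt (j : ℤ) {a b : ℤ} (h : ¬ (a = j ∧ b = j + 1)) (h' : ¬ (a = j + 1 ∧ b = j)) :
    sT j a < sT j b ↔ a < b := by
  simp only [sT, Equiv.swap_apply_def]
  split_ifs <;> omega

theorem sT_sq (j : ℤ) : sT j * sT j = 1 := Equiv.swap_mul_self _ _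

theorem inv_pos {u : Equiv.Perm ℤ} {j : ℤ} (h : u⁻¹ j < u⁻¹ (j + 1)) :
    Inv (sT j * u) = insert (u⁻¹ j, u⁻¹ (j + 1)) (Inv u) ∧ (u⁻¹ j, u⁻¹ (j + 1)) ∉ Inv u := by
  constructor
  · ext ⟨a, b⟩
    simp only [Inv, Set.mem_insert_iff, Set.mem_setOf_eq, Prod.mk.injEq, Equiv.Perm.mul_apply,
      Equiv.Perm.eq_inv_iff_eq]
    by_cases h1 : u a = j ∧ u b = j + 1
    · have ha : a = u⁻¹ j := by rw [← h1.1]; simp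
      have hb : b = u⁻¹ (j + 1) := by rw [← h1.2]; simp
      have : a < b := by rw [ha, hb]; exact h
      simp only [h1, this]
      simp [sT]
    · by_cases h2 : u a = j + 1 ∧ u b = j
      · have ha : b = u⁻¹ j := by rw [← h2.2]; simp
        have hb : a = u⁻¹ (j + 1) := by rw [← h2.1]; simp
        have : ¬ a < b := by rw [ha, hb]; exact not_lt.2 h.le
        simp only [h1, this, false_and, or_false]
      · rw [sT_lt j (by tauto) (by tauto)]
        tauto
  · simp [Inv]

theorem inv_neg {u : Equiv.Perm ℤ} {j : ℤ} (h : u⁻¹ (j + 1) < u⁻¹ j) :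
    Inv u = insert (u⁻¹ (j + 1), u⁻¹ j) (Inv (sT j * u)) ∧
      (u⁻¹ (j + 1), u⁻¹ j) ∉ Inv (sT j * u) := by
  have e1 : (sT j * u)⁻¹ j = u⁻¹ (j + 1) := by
    rw [Equiv.Perm.inv_eq_iff_eq]; simp [sT]
  have e2 : (sT j * u)⁻¹ (j + 1) = u⁻¹ j := by
    rw [Equiv.Perm.inv_eq_iff_eq]; simp [sT]
  have := inv_pos (u := sT j * u) (j := j) (by rw [e1, e2]; exact h)
  rw [e1, e2, ← mul_assoc, sT_sq, one_mul] at this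
  exact this

def PJ (l : List ℤ) : Equiv.Perm ℤ := (l.map sT).prod

theorem PJ_cons (j : ℤ) (l : List ℤ) : PJ (j :: l) = sT j * PJ l := by simp [PJ]

theorem inv_one : Inv 1 = ∅ := by
  ext ⟨a, b⟩
  simp only [Inv, Set.mem_setOf_eq, Equiv.Perm.one_apply, Set.mem_empty_iff_false, iff_false]
  omega

theorem inv_fin (l : List ℤ) : (Inv (PJ l)).Finite ∧ (Inv (PJ l)).ncard ≤ l.length := by
  induction l with
  | nil => simp [PJ, inv_one]
  | cons j l ih =>
    rw [PJ_cons]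
    rcases lt_trichotomy ((PJ l)⁻¹ j) ((PJ l)⁻¹ (j + 1)) with h | h | h
    · rw [(inv_pos h).1]
      exact ⟨ih.1.insert _, (Set.ncard_insert_le _ _).trans (by simp; exact ih.2)⟩
    · have := (PJ l)⁻¹.injective h; omega
    · have h1 := (inv_neg h).1
      have hsub : Inv (sT j * PJ l) ⊆ Inv (PJ l) := by rw [h1]; exact Set.subset_insert _ _
      refine ⟨ih.1.subset hsub, (Set.ncard_le_ncard hsub ih.1).trans (ih.2.trans (by simp))⟩

theorem fin_supp (l : List ℤ) : ∃ N : ℤ, 0 ≤ N ∧ ∀ x, N ≤ x ∨ x ≤ -N → PJ l x = x := by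
  induction l with
  | nil => exact ⟨0, le_rfl, fun x _ => rfl⟩
  | cons j l ih =>
    obtain ⟨N, h0, hN⟩ := ih
    refine ⟨N + |j| + 2, by positivity, fun x hx => ?_⟩
    have := abs_nonneg j
    have := le_abs_self j
    have := neg_abs_le j
    rw [PJ_cons, Equiv.Perm.mul_apply, hN x (by omega), sT, Equiv.swap_apply_of_ne_of_ne] <;> omega

theorem mono_one (l : List ℤ) (h : Inv (PJ l) = ∅) : PJ l = 1 := by
  obtain ⟨N, h0, hN⟩ := fin_supp l
  have hm : StrictMono (PJ l) := by
    intro a b hab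
    by_contra hcon
    have hne : PJ l a ≠ PJ l b := fun e => by have := (PJ l).injective e; omega
    have : (a, b) ∈ Inv (PJ l) := ⟨hab, by simp only; omega⟩
    rw [h] at this
    exact this
  have key : ∀ (k : ℕ) (a : ℤ), PJ l a + k ≤ PJ l (a + k) := by
    intro k a
    induction k with
    | zero => simp
    | succ k ih =>
      have := hm (show a + (k : ℤ) < a + ((k + 1 : ℕ) : ℤ) by push_cast; omega)
      push_cast at *
      omega
  ext x
  simp only [Equiv.Perm.one_apply]
  have h1 := key (N + |x| - x).toNat x
  have h2 := key (x + N + |x|).toNat (-N - |x|)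
  have := abs_nonneg x
  have := le_abs_self x
  have := neg_abs_le x
  rw [Int.toNat_of_nonneg (by omega), hN (x + _) (by omega)] at h1
  rw [Int.toNat_of_nonneg (by omega), hN (-N - |x|) (by omega)] at h2
  rw [show -N - |x| + (x + N + |x|) = x by ring] at h2
  omega

theorem exists_red (m : ℕ) : ∀ l : List ℤ, (Inv (PJ l)).ncard = m →
    ∃ l', l'.length = m ∧ PJ l' = PJ l := by
  induction m with
  | zero =>
    intro l hl
    have : Inv (PJ l) = ∅ := (Set.ncard_eq_zero (inv_fin l).1).1 hl
    exact ⟨[], rfl, by rw [mono_one l this]; rfl⟩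
  | succ m ih =>
    intro l hl
    have hex : ∃ j, (PJ l)⁻¹ (j + 1) < (PJ l)⁻¹ j := by
      by_contra hcon
      push Not at hcon
      have hm : StrictMono ((PJ l)⁻¹ : Equiv.Perm ℤ) := by
        apply strictMono_int_of_lt_succ
        intro j
        refine lt_of_le_of_ne (hcon j) fun e => ?_
        have := (PJ l)⁻¹.injective e; omega
      have : Inv (PJ l) = ∅ := by
        ext ⟨a, b⟩
        simp only [Inv, Set.mem_setOf_eq, Set.mem_empty_iff_false, iff_false, not_and, not_lt]
        intro hab
        by_contra hc
        have := hm (not_le.1 hc)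
        simp at this
        omega
      rw [this] at hl
      simp at hl
    obtain ⟨j, hj⟩ := hex
    obtain ⟨h1, h2⟩ := inv_neg hj
    have hf : (Inv (PJ (j :: l))).Finite := (inv_fin _).1
    rw [PJ_cons] at hf
    rw [h1, Set.ncard_insert_of_notMem h2 hf, ← PJ_cons] at hl
    obtain ⟨l', e1, e2⟩ := ih (j :: l) (by omega)
    refine ⟨j :: l', by simp [e1], ?_⟩
    rw [PJ_cons, e2, PJ_cons, ← mul_assoc, sT_sq, one_mul]

theorem len_eq (l : List ℤ) : len (PJ l) = (Inv (PJ l)).ncard := by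
  unfold len
  apply le_antisymm
  · apply Nat.sInf_le
    obtain ⟨l', e1, e2⟩ := exists_red _ l rfl
    exact ⟨l', e1, e2⟩
  · apply le_csInf
    · exact ⟨_, l, rfl, rfl⟩
    · rintro m ⟨l', rfl, e2⟩
      have : PJ l' = PJ l := e2
      rw [← this]
      exact (inv_fin l').2


def lat (p q : ℤ × ℤ) : Prop := q.2 < p.2 ∨ (p.2 = q.2 ∧ p.1 < q.1)

def idx (n : ℤ) (p : ℤ × ℤ) : ℤ := p.1 + p.2 - n - 1

def PL (n : ℤ) (l : List (ℤ × ℤ)) : Equiv.Perm ℤ := PJ (l.map (idx n))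

theorem wR_eq (n : ℤ) (R : Finset (ℤ × ℤ)) : wR n R = PL n (R.sort rcOrder) := by
  simp only [wR, PL, PJ, List.map_map]
  rfl

def pr (n : ℤ) (l : List (ℤ × ℤ)) (p : ℤ × ℤ) : ℤ × ℤ :=
  ((PL n (l.filter (fun q => lat p q)))⁻¹ (idx n p),
    (PL n (l.filter (fun q => lat p q)))⁻¹ (idx n p + 1))

theorem filt_head {a : ℤ × ℤ} {t : List (ℤ × ℤ)} (h : (a :: t).Pairwise lat) :
    (a :: t).filter (fun q => lat a q) = t := by
  rw [List.pairwise_cons] at h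
  rw [List.filter_cons_of_neg (by simp [lat])]
  rw [List.filter_eq_self]
  intro b hb
  simpa using h.1 b hb

theorem filt_tail {a p : ℤ × ℤ} {t : List (ℤ × ℤ)} (h : (a :: t).Pairwise lat) (hp : p ∈ t) :
    (a :: t).filter (fun q => lat p q) = t.filter (fun q => lat p q) := by
  rw [List.pairwise_cons] at h
  rw [List.filter_cons_of_neg]
  have h1 := h.1 p hp
  intro hcon
  have hcon2 : lat p a := by simpa using hcon
  simp only [lat] at h1 hcon2
  omega

theorem ap_main (n : ℤ) (l : List (ℤ × ℤ)) (hl : l.Pairwise lat)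
    (h : ∀ p ∈ l, (pr n l p).1 < (pr n l p).2) :
    Inv (PL n l) = pr n l '' {p | p ∈ l} ∧ Set.InjOn (pr n l) {p | p ∈ l} := by
  induction l with
  | nil => simp [PL, PJ, inv_one]
  | cons a t ih =>
    have ht := (List.pairwise_cons.1 hl).2
    have ha : a ∉ t := fun hh => by
      have := (List.pairwise_cons.1 hl).1 a hh
      simp [lat] at this
    have e1 : ∀ p ∈ t, pr n (a :: t) p = pr n t p := fun p hp => by
      rw [pr, filt_tail hl hp]; rfl
    have e2 : pr n (a :: t) a = ((PL n t)⁻¹ (idx n a), (PL n t)⁻¹ (idx n a + 1)) := by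
      rw [pr, filt_head hl]
    obtain ⟨i1, i2⟩ := ih ht (fun p hp => by rw [← e1 p hp]; exact h p (by simp [hp]))
    have hpos := h a (by simp)
    rw [e2] at hpos
    obtain ⟨j1, j2⟩ := inv_pos hpos
    have hPL : PL n (a :: t) = sT (idx n a) * PL n t := by simp [PL, PJ_cons]
    have hset : {p | p ∈ a :: t} = insert a {p | p ∈ t} := by ext; simp
    have him : pr n (a :: t) '' {p | p ∈ t} = pr n t '' {p | p ∈ t} :=
      Set.image_congr (fun p hp => e1 p hp)
    constructor
    · rw [hPL, j1, hset, Set.image_insert_eq, him, e2, i1]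
    · rw [hset, Set.injOn_insert (by simpa using ha), him, ← i1, e2]
      refine ⟨fun p hp q hq hpq => i2 hp hq ?_, j2⟩
      rwa [e1 p hp, e1 q hq] at hpq

theorem ap_ncard (n : ℤ) (l : List (ℤ × ℤ)) (hl : l.Pairwise lat)
    (h : (Inv (PL n l)).ncard = l.length) : ∀ p ∈ l, (pr n l p).1 < (pr n l p).2 := by
  induction l with
  | nil => simp
  | cons a t ih =>
    have ht := (List.pairwise_cons.1 hl).2
    have e1 : ∀ p ∈ t, pr n (a :: t) p = pr n t p := fun p hp => by
      rw [pr, filt_tail hl hp]; rfl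
    have e2 : pr n (a :: t) a = ((PL n t)⁻¹ (idx n a), (PL n t)⁻¹ (idx n a + 1)) := by
      rw [pr, filt_head hl]
    have hPL : PL n (a :: t) = sT (idx n a) * PL n t := by simp [PL, PJ_cons]
    have hf : (Inv (PL n t)).Finite := (inv_fin _).1
    have hc : (Inv (PL n t)).ncard ≤ t.length := by
      have := (inv_fin (t.map (idx n))).2
      rw [List.length_map] at this
      exact this
    rw [hPL] at h
    rcases lt_trichotomy ((PL n t)⁻¹ (idx n a)) ((PL n t)⁻¹ (idx n a + 1)) with hh | hh | hh
    · obtain ⟨j1, j2⟩ := inv_pos hh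
      rw [j1, Set.ncard_insert_of_notMem j2 hf, List.length_cons] at h
      have i := ih ht (by omega)
      intro p hp
      rcases List.mem_cons.1 hp with rfl | hp
      · rw [e2]; exact hh
      · rw [e1 p hp]; exact i p hp
    · have := (PL n t)⁻¹.injective hh; omega
    · exfalso
      have h1 := (inv_neg hh).1
      have hsub : Inv (sT (idx n a) * PL n t) ⊆ Inv (PL n t) := by
        rw [h1]; exact Set.subset_insert _ _
      have := Set.ncard_le_ncard hsub hf
      rw [h, List.length_cons] at this
      omega

theorem sort_lat (R : Finset (ℤ × ℤ)) : (R.sort rcOrder).Pairwise lat := by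
  have h1 := R.pairwise_sort rcOrder
  have h2 : (R.sort rcOrder).Pairwise (· ≠ ·) := R.sort_nodup rcOrder
  refine (h1.and h2).imp ?_
  rintro ⟨a, b⟩ ⟨c, d⟩ ⟨h, h'⟩
  simp only [rcOrder, lat, ne_eq, Prod.mk.injEq] at *
  omega

theorem sort_eq {R : Finset (ℤ × ℤ)} {l : List (ℤ × ℤ)} (hl : l.Pairwise lat)
    (h : ∀ p, p ∈ l ↔ p ∈ R) : R.sort rcOrder = l := by
  have hn : l.Nodup := hl.imp (by rintro a b h rfl; simp [lat] at h)
  refine List.Perm.eq_of_pairwise (le := lat) ?_ (sort_lat R) hl ?_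
  · intro a b _ _ h1 h2
    simp only [lat] at h1 h2
    omega
  · rw [List.perm_ext_iff_of_nodup (R.sort_nodup rcOrder) hn]
    intro a
    rw [h]; simp

theorem isRC_iff (n : ℤ) (R : Finset (ℤ × ℤ)) : IsRC n R ↔ (∀ p ∈ R, p.1 ≤ n ∧ p.2 ≤ n) ∧
    ∀ p ∈ R, (pr n (R.sort rcOrder) p).1 < (pr n (R.sort rcOrder) p).2 := by
  unfold IsRC
  refine and_congr_right fun _ => ?_
  have e : len (wR n R) = (Inv (PL n (R.sort rcOrder))).ncard := by
    rw [wR_eq]; exact len_eq _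
  have e2 : R.card = (R.sort rcOrder).length := (R.length_sort rcOrder).symm
  rw [e]
  constructor
  · intro h p hp
    exact ap_ncard n _ (sort_lat R) (by rw [h, e2]) p (by simpa using hp)
  · intro h
    obtain ⟨a1, a2⟩ := ap_main n _ (sort_lat R) (fun p hp => h p (by simpa using hp))
    rw [a1, Set.ncard_image_of_injOn a2]
    have : {p | p ∈ R.sort rcOrder} = (R : Set (ℤ × ℤ)) := by ext; simp
    rw [this, Set.ncard_coe_finset]

theorem PL_append (n : ℤ) (l m : List (ℤ × ℤ)) (v : ℤ) :
    (PL n (l ++ m))⁻¹ v = (PL n m)⁻¹ ((PL n l)⁻¹ v) := by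
  simp [PL, PJ, mul_inv_rev]

theorem PL_fix (n : ℤ) (l : List (ℤ × ℤ)) (v : ℤ) (h : ∀ p ∈ l, idx n p ≠ v ∧ idx n p ≠ v - 1) :
    (PL n l)⁻¹ v = v := by
  induction l with
  | nil => rfl
  | cons a t ih =>
    rw [show a :: t = [a] ++ t from rfl, PL_append]
    have h1 := h a (by simp)
    have : (PL n [a])⁻¹ v = v := by
      rw [Equiv.Perm.inv_eq_iff_eq]
      simp only [PL, PJ, List.map_cons, List.map_nil, List.prod_cons, List.prod_nil, mul_one, sT]
      rw [Equiv.swap_apply_of_ne_of_ne] <;> omega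
    rw [this]
    exact ih (fun p hp => h p (by simp [hp]))

theorem PL_one (n : ℤ) (a : ℤ × ℤ) (v : ℤ) :
    (PL n [a])⁻¹ v = Equiv.swap (idx n a) (idx n a + 1) v := by
  simp [PL, PJ, sT]

theorem PL_le (n : ℤ) (l : List (ℤ × ℤ)) (m v : ℤ) (h : ∀ p ∈ l, idx n p < m) (hv : v ≤ m) :
    (PL n l)⁻¹ v ≤ m := by
  induction l generalizing v with
  | nil => exact hv
  | cons a t ih =>
    rw [show a :: t = [a] ++ t from rfl, PL_append, PL_one]
    apply ih _ (fun p hp => h p (by simp [hp]))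
    have h1 := h a (by simp)
    rw [Equiv.swap_apply_def]
    split_ifs <;> omega

theorem lat_uniq {l m : List (ℤ × ℤ)} (hl : l.Pairwise lat) (hm : m.Pairwise lat)
    (h : ∀ p, p ∈ l ↔ p ∈ m) : l = m := by
  have nd : ∀ {l : List (ℤ × ℤ)}, l.Pairwise lat → l.Nodup :=
    fun hl => hl.imp (by rintro a b h rfl; simp [lat] at h)
  refine List.Perm.eq_of_pairwise (le := lat) ?_ hl hm ?_
  · intro a b _ _ h1 h2
    simp only [lat] at h1 h2
    omega
  · rw [List.perm_ext_iff_of_nodup (nd hl) (nd hm)]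
    exact h

/-- later crossings -/
def LL (R : Finset (ℤ × ℤ)) (i k : ℤ) : List (ℤ × ℤ) :=
  (R.sort rcOrder).filter (fun q => lat (i, k) q)

theorem mem_LL {R : Finset (ℤ × ℤ)} {i k : ℤ} {q : ℤ × ℤ} :
    q ∈ LL R i k ↔ q ∈ R ∧ (q.2 < k ∨ (k = q.2 ∧ i < q.1)) := by
  unfold LL
  rw [List.mem_filter, Finset.mem_sort, decide_eq_true_eq]
  rfl

theorem LL_pw (R : Finset (ℤ × ℤ)) (i k : ℤ) : (LL R i k).Pairwise lat :=
  (sort_lat R).sublist List.filter_sublist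

def sing (R : Finset (ℤ × ℤ)) (p : ℤ × ℤ) : List (ℤ × ℤ) := if p ∈ R then [p] else []

theorem mem_sing {R : Finset (ℤ × ℤ)} {p q : ℤ × ℤ} : q ∈ sing R p ↔ p ∈ R ∧ q = p := by
  unfold sing; split_ifs with h <;> simp [h]

theorem sing_pw (R : Finset (ℤ × ℤ)) (p : ℤ × ℤ) : (sing R p).Pairwise lat := by
  unfold sing; split_ifs with h <;> simp

theorem LL_row (R : Finset (ℤ × ℤ)) (i k : ℤ) :
    LL R i k = sing R (i + 1, k) ++ LL R (i + 1) k := by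
  apply lat_uniq (LL_pw _ _ _)
  · rw [List.pairwise_append]
    refine ⟨sing_pw _ _, LL_pw _ _ _, ?_⟩
    intro a ha b hb
    rw [mem_sing] at ha
    rw [mem_LL] at hb
    obtain ⟨_, rfl⟩ := ha
    simp only [lat]; omega
  · rintro ⟨x, y⟩
    rw [List.mem_append, mem_sing, mem_LL, mem_LL]
    simp only [Prod.mk.injEq]
    constructor
    · rintro ⟨h1, h2⟩
      by_cases h : x = i + 1 ∧ y = k
      · left; rw [h.1, h.2] at h1; exact ⟨h1, h⟩
      · right; exact ⟨h1, by omega⟩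
    · rintro (⟨h1, h2, h3⟩ | ⟨h1, h2⟩)
      · subst h2 h3; exact ⟨h1, by omega⟩
      · exact ⟨h1, by omega⟩

theorem LL_col (R : Finset (ℤ × ℤ)) (i k : ℤ) :
    LL R i k = ((R.sort rcOrder).filter (fun q => q.2 = k ∧ i < q.1) ++
      (R.sort rcOrder).filter (fun q => q.2 = k - 1 ∧ q.1 < i)) ++
      (sing R (i, k - 1) ++ LL R i (k - 1)) := by
  apply lat_uniq (LL_pw _ _ _)
  · rw [List.pairwise_append, List.pairwise_append, List.pairwise_append]
    refine ⟨⟨(sort_lat R).sublist List.filter_sublist,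
      (sort_lat R).sublist List.filter_sublist, ?_⟩, ⟨sing_pw _ _, LL_pw _ _ _, ?_⟩, ?_⟩
    · intro a ha b hb
      simp at ha hb
      simp only [lat]; omega
    · intro a ha b hb
      rw [mem_sing] at ha
      rw [mem_LL] at hb
      obtain ⟨_, rfl⟩ := ha
      simp only [lat]; omega
    · intro a ha b hb
      simp [mem_sing, mem_LL] at ha hb
      rcases hb with ⟨_, rfl⟩ | hb
      · simp only [lat]; omega
      · simp only [lat]; omega
  · rintro ⟨x, y⟩
    simp only [List.mem_append, mem_sing, mem_LL, List.mem_filter, Finset.mem_sort,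
      decide_eq_true_eq, Prod.mk.injEq]
    constructor
    · rintro ⟨h1, h2⟩
      by_cases h : x = i ∧ y = k - 1
      · right; left; rw [h.1, h.2] at h1; exact ⟨h1, h⟩
      · simp only [h1, true_and]; omega
    · rintro ((⟨h1, h2⟩ | ⟨h1, h2⟩) | ⟨h1, h2, h3⟩ | ⟨h1, h2⟩)
      · exact ⟨h1, by omega⟩
      · exact ⟨h1, by omega⟩
      · subst h2 h3; exact ⟨h1, by omega⟩
      · exact ⟨h1, by omega⟩

theorem LL_colx (n : ℤ) (R : Finset (ℤ × ℤ)) (i k : ℤ) : ∃ X, LL R i k = X ++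
    (sing R (i, k - 1) ++ LL R i (k - 1)) ∧ (PL n X)⁻¹ (i + k - n - 1) = i + k - n - 1 := by
  refine ⟨_, LL_col R i k, PL_fix _ _ _ ?_⟩
  intro p hp
  simp at hp
  simp only [idx]; omega

def rng (n : ℤ) (R : Finset (ℤ × ℤ)) : Prop := ∀ p ∈ R, p.1 ≤ n ∧ 1 ≤ p.2 ∧ p.2 ≤ n

theorem lab_eq {n : ℤ} {R : Finset (ℤ × ℤ)} (hR : rng n R) (N : ℕ) : ∀ i k : ℤ, i ≤ n →
    (n - i).toNat + k.toNat ≤ N →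
    lab n R true i k = (PL n (LL R i k))⁻¹ (i + k - n) ∧
    lab n R false i k = (PL n (LL R i k))⁻¹ (i + k - n - 1) := by
  induction N using Nat.strong_induction_on with
  | _ N ih =>
  intro i k hi hN
  constructor
  · rw [lab]
    split_ifs with h1 h2
    · have : i = n := le_antisymm hi h1
      subst this
      rw [PL_fix]
      · ring
      · intro p hp
        rw [mem_LL] at hp
        have := hR p hp.1
        simp only [idx]; omega
    · rw [LL_row, sing, if_pos h2, PL_append, PL_one]
      rw [(ih ((n - (i + 1)).toNat + k.toNat) (by omega) (i + 1) k (by omega) le_rfl).1]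
      congr 1
      rw [show idx n (i + 1, k) = i + k - n by simp [idx]; ring, Equiv.swap_apply_left]
      ring
    · rw [LL_row, sing, if_neg h2, List.nil_append]
      rw [(ih ((n - (i + 1)).toNat + k.toNat) (by omega) (i + 1) k (by omega) le_rfl).2]
      congr 1
      ring
  · rw [lab]
    split_ifs with h1 h2
    · rw [PL_fix]
      intro p hp
      rw [mem_LL] at hp
      have := hR p hp.1
      omega
    · obtain ⟨X, hX1, hX2⟩ := LL_colx n R i k
      rw [hX1, PL_append, hX2, sing, if_pos h2, PL_append, PL_one]
      · rw [(ih ((n - i).toNat + (k - 1).toNat) (by omega) i (k - 1) (by omega) le_rfl).2]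
        congr 1
        rw [show i + k - n - 1 = idx n (i, k - 1) + 1 by simp [idx]; ring, Equiv.swap_apply_right]
        simp [idx]
    · obtain ⟨X, hX1, hX2⟩ := LL_colx n R i k
      rw [hX1, PL_append, hX2, sing, if_neg h2, List.nil_append]
      · rw [(ih ((n - i).toNat + (k - 1).toNat) (by omega) i (k - 1) (by omega) le_rfl).1]
        congr 1
        ring

theorem pr_lab {n : ℤ} {R : Finset (ℤ × ℤ)} (hR : rng n R) {p : ℤ × ℤ} (hp : p ∈ R) :
    pr n (R.sort rcOrder) p = (lab n R false p.1 p.2, lab n R true p.1 p.2) := by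
  obtain ⟨h1, h2⟩ := lab_eq hR _ p.1 p.2 (hR p hp).1 le_rfl
  rw [h1, h2, pr]
  simp only [LL, idx, Prod.mk.eta]
  rw [show p.1 + p.2 - n - 1 + 1 = p.1 + p.2 - n by ring]

theorem A2 {n : ℤ} {R : Finset (ℤ × ℤ)} (hR : rng n R) :
    IsRC n R ↔ ∀ p ∈ R, lab n R false p.1 p.2 < lab n R true p.1 p.2 := by
  rw [isRC_iff]
  constructor
  · rintro ⟨_, h⟩ p hp
    have := h p hp
    rwa [pr_lab hR hp] at this
  · intro h
    refine ⟨fun p hp => ⟨(hR p hp).1, (hR p hp).2.2⟩, fun p hp => ?_⟩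
    rw [pr_lab hR hp]
    exact h p hp

theorem A3 {n : ℤ} {R : Finset (ℤ × ℤ)} (hR : rng n R)
    (h : ∀ p ∈ R, lab n R false p.1 p.2 < lab n R true p.1 p.2) {p q : ℤ × ℤ}
    (hp : p ∈ R) (hq : q ∈ R) (h1 : lab n R false p.1 p.2 = lab n R false q.1 q.2)
    (h2 : lab n R true p.1 p.2 = lab n R true q.1 q.2) : p = q := by
  have := (ap_main n _ (sort_lat R) (fun p hp => by
    rw [pr_lab hR (by simpa using hp)]; exact h p (by simpa using hp))).2
  apply this (by simpa using hp) (by simpa using hq)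
  rw [pr_lab hR hp, pr_lab hR hq, h1, h2]

theorem star_mono {n : ℤ} {R : Finset (ℤ × ℤ)} (hS : Star n R) (b : ℤ) (hb : b ≤ 0) (m : ℕ) :
    wR n R (b - (m + 1 : ℕ)) < wR n R b := by
  induction m with
  | zero => simpa using hS b hb
  | succ m ih =>
    have := hS (b - (m + 1 : ℕ)) (by omega)
    rw [show b - ((m + 1 + 1 : ℕ) : ℤ) = b - (m + 1 : ℕ) - 1 by push_cast; ring]
    omega

theorem A1 {n : ℤ} {R : Finset (ℤ × ℤ)} (hRC : IsRC n R) (hS : Star n R) :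
    rng n R ∧ ∀ p ∈ R, 0 < lab n R true p.1 p.2 := by
  obtain ⟨hr, h⟩ := (isRC_iff n R).1 hRC
  have key : ∀ p ∈ R, 0 < (pr n (R.sort rcOrder) p).2 := by
    intro p hp
    by_contra hc
    have hm := (ap_main n _ (sort_lat R) (fun p hp => h p (by simpa using hp))).1
    have h1 : pr n (R.sort rcOrder) p ∈ Inv (PL n (R.sort rcOrder)) := by
      rw [hm]; exact ⟨p, by simpa using hp, rfl⟩
    obtain ⟨h2, h3⟩ := h1
    have := star_mono hS _ (not_lt.1 hc)
      ((pr n (R.sort rcOrder) p).2 - (pr n (R.sort rcOrder) p).1 - 1).toNat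
    rw [wR_eq] at this
    rw [show (pr n (R.sort rcOrder) p).2 - (((((pr n (R.sort rcOrder) p).2 -
      (pr n (R.sort rcOrder) p).1 - 1).toNat + 1 : ℕ)) : ℤ) = (pr n (R.sort rcOrder) p).1 by
        push_cast; omega] at this
    omega
  have hrng : rng n R := by
    intro p hp
    refine ⟨(hr p hp).1, ?_, (hr p hp).2⟩
    by_contra hc
    have := key p hp
    have h2 : (pr n (R.sort rcOrder) p).2 ≤ p.2 := by
      apply PL_le
      · intro q hq
        have hq2 : q ∈ LL R p.1 p.2 := hq
        rw [mem_LL] at hq2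
        have := hr q hq2.1
        simp only [idx]
        omega
      · have := hr p hp
        simp only [idx]; omega
    omega
  refine ⟨hrng, fun p hp => ?_⟩
  have := key p hp
  rwa [pr_lab hrng hp] at this

def ofD (n : ℕ) (D : ℕ → Finset ℕ) : Finset (ℤ × ℤ) :=
  (Finset.Icc 1 n).biUnion fun s : ℕ => (D s).image fun c : ℕ => ((n : ℤ) - (c : ℤ), (s : ℤ))

theorem mem_ofD' {n : ℕ} {D : ℕ → Finset ℕ} {p : ℤ × ℤ} : p ∈ ofD n D ↔
    ∃ s c : ℕ, 1 ≤ s ∧ s ≤ n ∧ c ∈ D s ∧ p = ((n : ℤ) - (c : ℤ), (s : ℤ)) := by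
  simp only [ofD, Finset.mem_biUnion, Finset.mem_Icc, Finset.mem_image]
  constructor
  · rintro ⟨s, ⟨h1, h2⟩, c, h3, rfl⟩
    exact ⟨s, c, h1, h2, h3, rfl⟩
  · rintro ⟨s, c, h1, h2, h3, rfl⟩
    exact ⟨s, ⟨h1, h2⟩, c, h3, rfl⟩

theorem mem_ofD {n : ℕ} {D : ℕ → Finset ℕ} {s c : ℕ} :
    ((n : ℤ) - (c : ℤ), (s : ℤ)) ∈ ofD n D ↔ 1 ≤ s ∧ s ≤ n ∧ c ∈ D s := by
  rw [mem_ofD']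
  constructor
  · rintro ⟨s', c', h1, h2, h3, h4⟩
    simp only [Prod.mk.injEq] at h4
    have e1 : s = s' := by omega
    have e2 : c = c' := by omega
    subst e1 e2
    exact ⟨h1, h2, h3⟩
  · rintro ⟨h1, h2, h3⟩
    exact ⟨s, c, h1, h2, h3, rfl⟩

theorem rng_ofD (n : ℕ) (D : ℕ → Finset ℕ) : rng n (ofD n D) := by
  intro p hp
  obtain ⟨s, c, h1, h2, h3, rfl⟩ := mem_ofD'.1 hp
  refine ⟨?_, ?_, ?_⟩ <;> simp only <;> omega

theorem ofD_congr {n : ℕ} {D E : ℕ → Finset ℕ} (h : ∀ s, 1 ≤ s → s ≤ n → D s = E s) :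
    ofD n D = ofD n E := by
  ext p
  rw [mem_ofD', mem_ofD']
  constructor
  · rintro ⟨s, c, h1, h2, h3, e⟩
    exact ⟨s, c, h1, h2, h s h1 h2 ▸ h3, e⟩
  · rintro ⟨s, c, h1, h2, h3, e⟩
    exact ⟨s, c, h1, h2, (h s h1 h2).symm ▸ h3, e⟩

theorem exists_ofD {n : ℕ} {R : Finset (ℤ × ℤ)} (h : rng n R) : ∃ D, R = ofD n D := by
  refine ⟨fun s => (R.filter (fun p => p.2 = (s : ℤ))).image (fun p => ((n : ℤ) - p.1).toNat), ?_⟩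
  ext ⟨x, y⟩
  rw [mem_ofD']
  constructor
  · intro hp
    have := h _ hp
    simp only at this
    refine ⟨y.toNat, ((n : ℤ) - x).toNat, by omega, by omega, ?_, ?_⟩
    · rw [Finset.mem_image]
      exact ⟨(x, y), by rw [Finset.mem_filter]; exact ⟨hp, by simp only; omega⟩, rfl⟩
    · rw [Prod.mk.injEq]; omega
  · rintro ⟨s, c, h1, h2, h3, h4⟩
    rw [Finset.mem_image] at h3
    obtain ⟨⟨a, b⟩, h5, h6⟩ := h3
    rw [Finset.mem_filter] at h5
    rw [Prod.mk.injEq] at h4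
    have h7 := h _ h5.1
    have h8 := h5.2
    simp only at h6 h7 h8
    have e1 : x = a := by omega
    have e2 : y = b := by omega
    rw [e1, e2]; exact h5.1

theorem labT {n : ℕ} {D : ℕ → Finset ℕ} {s : ℕ} (hs : s < n) {σ : ℕ → ℤ}
    (h : ∀ c : ℕ, lab n (ofD n D) false ((n : ℤ) - (c : ℤ)) ((s + 1 : ℕ) : ℤ) = σ c) (c : ℕ) :
    lab n (ofD n D) true ((n : ℤ) - (c : ℤ)) ((s + 1 : ℕ) : ℤ) =
      hh ((s + 1 : ℕ) : ℤ) σ (D (s + 1)) c := by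
  induction c with
  | zero => rw [lab, dif_pos (by simp)]; rfl
  | succ c ih =>
    rw [lab, dif_neg (by push_cast; omega)]
    rw [show (n : ℤ) - ((c + 1 : ℕ) : ℤ) + 1 = (n : ℤ) - (c : ℤ) by push_cast; ring]
    rw [hh_succ, ih, h c]
    have : ((n : ℤ) - (c : ℤ), ((s + 1 : ℕ) : ℤ)) ∈ ofD n D ↔ c ∈ D (s + 1) := by
      rw [mem_ofD]
      exact ⟨fun h => h.2.2, fun h => ⟨by omega, by omega, h⟩⟩
    simp only [this]

theorem labF {n : ℕ} {D : ℕ → Finset ℕ} {s : ℕ} : s < n → ∀ c : ℕ,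
    lab n (ofD n D) false ((n : ℤ) - (c : ℤ)) ((s + 1 : ℕ) : ℤ) = lv D s c := by
  induction s with
  | zero =>
    intro hs c
    have hno : ∀ x, (x, (0 : ℤ)) ∉ ofD n D := fun x hx => by
      have := rng_ofD n D _ hx
      simp only at this; omega
    rw [lab, dif_neg (by simp)]
    simp only [zero_add, Nat.cast_one, sub_self, hno, if_false]
    rw [lab]
    split_ifs with h1 h2
    · show _ = -(c : ℤ)
      omega
    · exact absurd h2 (hno _)
    · rw [lab, dif_pos le_rfl]
      show _ = -(c : ℤ)
      ring
  | succ s ih =>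
    intro hs c
    have h1 := ih (by omega)
    have h2 := labT (by omega) h1
    rw [lab, dif_neg (by push_cast; omega)]
    rw [show ((s + 1 + 1 : ℕ) : ℤ) - 1 = ((s + 1 : ℕ) : ℤ) by push_cast; ring]
    rw [h1, h2]
    have : ((n : ℤ) - (c : ℤ), ((s + 1 : ℕ) : ℤ)) ∈ ofD n D ↔ c ∈ D (s + 1) := by
      rw [mem_ofD]
      exact ⟨fun h => h.2.2, fun h => ⟨by omega, by omega, h⟩⟩
    simp only [this]
    rfl

theorem labT' {n : ℕ} {D : ℕ → Finset ℕ} {s : ℕ} (hs : s < n) (c : ℕ) :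
    lab n (ofD n D) true ((n : ℤ) - (c : ℤ)) ((s + 1 : ℕ) : ℤ) =
      hh ((s + 1 : ℕ) : ℤ) (lv D s) (D (s + 1)) c := labT hs (labF hs) c

theorem pos_of_good {n : ℕ} {D : ℕ → Finset ℕ} (hG : GoodD n D) : ∀ p ∈ ofD n D,
    lab n (ofD n D) false p.1 p.2 < lab n (ofD n D) true p.1 p.2 := by
  intro p hp
  obtain ⟨s, c, h1, h2, h3, rfl⟩ := mem_ofD'.1 hp
  obtain ⟨s, rfl⟩ : ∃ t, s = t + 1 := ⟨s - 1, by omega⟩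
  simp only
  rw [labF (by omega), labT' (by omega)]
  exact ((hG s (by omega)).2 c h3).1

theorem rc_of_good {n : ℕ} {D : ℕ → Finset ℕ} (hG : GoodD n D) : IsRC n (ofD n D) :=
  (A2 (rng_ofD n D)).2 (pos_of_good hG)

theorem good_of_star {n : ℕ} {R : Finset (ℤ × ℤ)} (hRC : IsRC n R) (hS : Star n R) :
    ∃ D, R = ofD n D ∧ GoodD n D := by
  obtain ⟨h1, h2⟩ := A1 hRC hS
  obtain ⟨D, rfl⟩ := exists_ofD h1
  refine ⟨D, rfl, fun s hs => ⟨by omega, fun c hc => ?_⟩⟩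
  have hm : ((n : ℤ) - (c : ℤ), ((s + 1 : ℕ) : ℤ)) ∈ ofD n D :=
    mem_ofD.2 ⟨by omega, by omega, hc⟩
  have h3 := h2 _ hm
  have h4 := (A2 h1).1 hRC _ hm
  simp only at h3 h4
  rw [labT' hs] at h3 h4
  rw [labF hs] at h4
  exact ⟨h4, h3⟩

theorem uniqD {n : ℕ} {D : ℕ → Finset ℕ} (hG : GoodD n D) {r s c d : ℕ} (hr : r < n) (hs : s < n)
    (hc : c ∈ D (r + 1)) (hd : d ∈ D (s + 1)) (h1 : lv D r c = lv D s d)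
    (h2 : hh ((r + 1 : ℕ) : ℤ) (lv D r) (D (r + 1)) c =
      hh ((s + 1 : ℕ) : ℤ) (lv D s) (D (s + 1)) d) : r = s ∧ c = d := by
  have hm : ((n : ℤ) - (c : ℤ), ((r + 1 : ℕ) : ℤ)) ∈ ofD n D :=
    mem_ofD.2 ⟨by omega, by omega, hc⟩
  have hm' : ((n : ℤ) - (d : ℤ), ((s + 1 : ℕ) : ℤ)) ∈ ofD n D :=
    mem_ofD.2 ⟨by omega, by omega, hd⟩
  have := A3 (rng_ofD n D) (pos_of_good hG) hm hm' (by
    simp only; rw [labF hr, labF hs, h1]) (by simp only; rw [labT' hr, labT' hs, h2])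
  rw [Prod.mk.injEq] at this
  omega

theorem hh_cases (r : ℤ) (σ : ℕ → ℤ) (C : Finset ℕ) (c : ℕ) :
    (hh r σ C c = r ∧ ∀ x < c, x ∈ C) ∨
    ∃ d < c, d ∉ C ∧ hh r σ C c = σ d ∧ ∀ x, d < x → x < c → x ∈ C := by
  induction c with
  | zero => left; exact ⟨rfl, fun x hx => by omega⟩
  | succ c ih =>
    by_cases hc : c ∈ C
    · rw [hh_in hc]
      rcases ih with ⟨h1, h2⟩ | ⟨d, h1, h2, h3, h4⟩
      · left; refine ⟨h1, fun x hx => ?_⟩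
        rcases Nat.lt_succ_iff_lt_or_eq.1 hx with h | rfl
        · exact h2 x h
        · exact hc
      · right; refine ⟨d, by omega, h2, h3, fun x hx hx' => ?_⟩
        rcases Nat.lt_succ_iff_lt_or_eq.1 hx' with h | rfl
        · exact h4 x hx h
        · exact hc
    · right; exact ⟨c, by omega, hc, hh_out hc, fun x h1 h2 => by omega⟩

theorem out_inj {r : ℤ} {σ : ℕ → ℤ} {C : Finset ℕ} (hσ : Function.Injective σ)
    (hr : ∀ x, σ x < r) : Function.Injective (outR r σ C) := by
  have key : ∀ x y, x < y → outR r σ C x ≠ outR r σ C y := by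
    intro x y hxy he
    by_cases hx : x ∈ C <;> by_cases hy : y ∈ C
    · rw [out_in hx, out_in hy] at he
      have := hσ he; omega
    · rw [out_in hx, out_out hy] at he
      rcases hh_cases r σ C y with ⟨h1, h2⟩ | ⟨d, h1, h2, h3, h4⟩
      · have := hr x; omega
      · rw [h3] at he
        have := hσ he
        subst this
        exact h2 hx
    · rw [out_out hx, out_in hy] at he
      rcases hh_cases r σ C x with ⟨h1, h2⟩ | ⟨d, h1, h2, h3, h4⟩
      · have := hr y; omega
      · rw [h3] at he
        have := hσ he
        omega
    · rw [out_out hx, out_out hy] at he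
      rcases hh_cases r σ C y with ⟨h1, h2⟩ | ⟨d, h1, h2, h3, h4⟩
      · exact hx (h2 x hxy)
      · have hd : x ≤ d := by
          by_contra hc
          exact hx (h4 x (by omega) hxy)
        rcases hh_cases r σ C x with ⟨h1', h2'⟩ | ⟨d', h1', h2', h3', h4'⟩
        · have := hr d; omega
        · rw [h3, h3'] at he
          have := hσ he
          omega
  intro x y he
  rcases lt_trichotomy x y with h | h | h
  · exact absurd he (key x y h)
  · exact h
  · exact absurd he.symm (key y x h)

theorem lv_le (D : ℕ → Finset ℕ) (s : ℕ) : ∀ x, lv D s x ≤ s := by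
  induction s with
  | zero => intro x; show -(x : ℤ) ≤ _; omega
  | succ s ih =>
    intro x
    show outR _ _ _ x ≤ _
    by_cases hx : x ∈ D (s + 1)
    · rw [out_in hx]; have := ih x; omega
    · rw [out_out hx]
      rcases hh_cases ((s + 1 : ℕ) : ℤ) (lv D s) (D (s + 1)) x with ⟨h1, _⟩ | ⟨d, _, _, h3, _⟩
      · rw [h1]
      · rw [h3]; have := ih d; omega

theorem lv_inj (D : ℕ → Finset ℕ) (s : ℕ) : Function.Injective (lv D s) := by
  induction s with
  | zero =>
    intro x y h
    have : -(x : ℤ) = -(y : ℤ) := h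
    omega
  | succ s ih =>
    exact out_inj ih (fun x => by have := lv_le D s x; omega)

theorem step_inv {r : ℤ} {σ : ℕ → ℤ} {C C' : Finset ℕ} {c d : ℕ} {o : Mv}
    (h : Step r σ C (.mv c d) C' o) :
    (C' = C ∧ o = .mv (ff C c) (ff C d) ∧ ¬ (c ∉ C ∧ d = c + 1 ∧ d ∈ C)) ∨
    (d = c + 1 ∧ c ∉ C ∧ c + 1 ∈ C ∧ ∃ e, e ≤ c ∧ 0 < outR r σ C e ∧
      (∀ x, e < x → x ≤ c → outR r σ C x ≤ 0) ∧ C' = insert e (C.erase (c + 1)) ∧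
      o = .mv e (e + 1)) := by
  cases h with
  | bump _ e hc hd he h1 h2 => right; exact ⟨rfl, hc, hd, e, he, h1, h2, rfl, rfl⟩
  | keep _ _ hk => left; exact ⟨rfl, rfl, hk⟩

theorem emp_inv {r : ℤ} {σ : ℕ → ℤ} {C C' : Finset ℕ} {o : Mv}
    (h : Step r σ C .emp C' o) :
    ∃ e, 0 < outR r σ C e ∧ (∀ x, e < x → outR r σ C x ≤ 0) ∧ C' = insert e C ∧
      o = .mv e (e + 1) := by
  cases h with
  | emp e h1 h2 => exact ⟨e, h1, h2, rfl, rfl⟩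

theorem nil_inv {r : ℤ} {σ : ℕ → ℤ} {C C' : Finset ℕ} {o : Mv}
    (h : Step r σ C .nil C' o) : C' = C := by
  cases h; rfl

def mix (t : ℕ) (D D' : ℕ → Finset ℕ) (s : ℕ) : Finset ℕ := if s ≤ t then D' s else D s

theorem lv_congr {D E : ℕ → Finset ℕ} {s : ℕ} (h : ∀ r, 1 ≤ r → r ≤ s → D r = E r) :
    lv D s = lv E s := by
  induction s with
  | zero => rfl
  | succ s ih =>
    show outR _ _ _ = outR _ _ _
    rw [ih (fun r h1 h2 => h r h1 (by omega)), h (s + 1) (by omega) le_rfl]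

theorem hh_map {r : ℤ} {σ τ : ℕ → ℤ} {C : Finset ℕ} (f : ℤ → ℤ) (hf : f r = r)
    (h : ∀ x, τ x = f (σ x)) (c : ℕ) : hh r τ C c = f (hh r σ C c) := by
  induction c with
  | zero => rw [hh_zero, hh_zero, hf]
  | succ c ih => rw [hh_succ, hh_succ, ih, h]; split_ifs <;> rfl

theorem out_map {r : ℤ} {σ τ : ℕ → ℤ} {C : Finset ℕ} (f : ℤ → ℤ) (hf : f r = r)
    (h : ∀ x, τ x = f (σ x)) (c : ℕ) : outR r τ C c = f (outR r σ C c) := by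
  unfold outR
  rw [hh_map f hf h, h]; split_ifs <;> rfl

theorem lv_map {D E : ℕ → Finset ℕ} {s : ℕ} (f : ℤ → ℤ) (hf : ∀ r : ℤ, s < r → f r = r)
    (hDE : ∀ r, s < r → E r = D r) (h : ∀ x, lv E s x = f (lv D s x)) (j : ℕ) :
    ∀ x, lv E (s + j) x = f (lv D (s + j) x) := by
  induction j with
  | zero => exact h
  | succ j ih =>
    intro x
    show outR ((s + j + 1 : ℕ) : ℤ) (lv E (s + j)) (E (s + j + 1)) x =
      f (outR ((s + j + 1 : ℕ) : ℤ) (lv D (s + j)) (D (s + j + 1)) x)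
    rw [hDE _ (by omega)]
    exact out_map f (hf _ (by push_cast; omega)) ih x

theorem find_q {n : ℕ} {D E : ℕ → Finset ℕ} (hG : GoodD n D) {s c r c' : ℕ} (hs : s < n)
    (hc : c ∉ D (s + 1)) (hd : c + 1 ∈ D (s + 1)) (ha : 0 < lv D s c) (hb : lv D s (c + 1) ≤ 0)
    (hE : lv E s = app (.mv c (c + 1)) (lv D s)) (hDE : ∀ r, s < r → E r = D r)
    (hsr : s ≤ r) (hr : r < n) (hc' : c' ∈ E (r + 1))
    (hl : (hh ((r + 1 : ℕ) : ℤ) (lv E r) (E (r + 1)) c' = lv D s c ∧ lv E r c' = lv D s (c + 1)) ∨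
      (hh ((r + 1 : ℕ) : ℤ) (lv E r) (E (r + 1)) c' = lv D s (c + 1) ∧ lv E r c' = lv D s c)) :
    r = s ∧ c' = c + 1 := by
  set a := lv D s c with hadef
  set b := lv D s (c + 1) with hbdef
  have hfix : ∀ r : ℤ, s < r → Equiv.swap a b r = r := by
    intro r hr
    have := lv_le D s c
    have := lv_le D s (c + 1)
    apply Equiv.swap_apply_of_ne_of_ne <;> omega
  have h0 : ∀ x, lv E s x = Equiv.swap a b (lv D s x) := by
    intro x
    rw [hE]
    simp only [app]
    split_ifs with h1 h2
    · rw [h1, ← hadef, Equiv.swap_apply_left]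
    · rw [h2, ← hbdef, Equiv.swap_apply_right]
    · rw [Equiv.swap_apply_of_ne_of_ne]
      · exact fun e => h1 (lv_inj D s e)
      · exact fun e => h2 (lv_inj D s e)
  have h1 : ∀ x, lv E r x = Equiv.swap a b (lv D r x) := by
    obtain ⟨j, rfl⟩ := Nat.exists_eq_add_of_le hsr
    exact lv_map _ hfix hDE h0 j
  have h2 := hh_map (r := ((r + 1 : ℕ) : ℤ)) (C := E (r + 1)) (Equiv.swap a b)
    (hfix _ (by push_cast; omega)) h1 c'
  rw [hDE _ (by omega)] at hc' h2 hl
  rw [h2, h1] at hl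
  have hlt := ((hG r hr).2 c' hc').1
  have conv : ∀ x y, Equiv.swap a b x = y → x = Equiv.swap a b y := by
    rintro x y rfl; simp
  rcases hl with ⟨l1, l2⟩ | ⟨l1, l2⟩
  · have l1 := conv _ _ l1
    have l2 := conv _ _ l2
    rw [Equiv.swap_apply_left] at l1
    rw [Equiv.swap_apply_right] at l2
    omega
  · have l1 := conv _ _ l1
    have l2 := conv _ _ l2
    rw [Equiv.swap_apply_right] at l1
    rw [Equiv.swap_apply_left] at l2
    exact uniqD hG hr hs hc' hd l2 (by rw [l1, hh_out hc])

theorem hh_congr {r : ℤ} {σ τ : ℕ → ℤ} {C C' : Finset ℕ} {c : ℕ} (h : ∀ x < c, σ x = τ x)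
    (hC : ∀ x < c, x ∈ C ↔ x ∈ C') : ∀ x ≤ c, hh r σ C x = hh r τ C' x := by
  intro x
  induction x with
  | zero => intro _; rfl
  | succ x ih =>
    intro hx
    rw [hh_succ, hh_succ, ih (by omega), h x (by omega)]
    simp only [hC x (by omega)]

theorem keep_chain {n k : ℕ} {D D' : ℕ → Finset ℕ} {M : ℕ → Mv} (hG : GoodD n D)
    (h : InsAb n k D D' M) {t e : ℕ} (hk : k ≤ t + 1) (hM : M (t + 1) = .mv e (e + 1)) (j : ℕ)
    (hj : t + 1 + j ≤ n) (hD : ∀ r, t + 1 ≤ r → r < t + 1 + j → D' (r + 1) = D (r + 1)) :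
    ∃ c d, M (t + 1 + j) = .mv c d ∧ lv D (t + 1 + j) c = lv D (t + 1) e ∧
      lv D (t + 1 + j) d = lv D (t + 1) (e + 1) := by
  induction j with
  | zero => exact ⟨e, e + 1, hM, rfl, rfl⟩
  | succ j ih =>
    obtain ⟨c, d, h1, h2, h3⟩ := ih (by omega) (fun r a b => hD r a (by omega))
    have st := h.step (t + 1 + j) (by omega)
    rw [inp, if_neg (by omega), h1] at st
    have hV := hG (t + 1 + j) (by omega)
    have hm := (ab_main hG h (t + 1 + j) (by omega)).2.1
    rw [h1] at hm
    have hDD := hD (t + 1 + j) (by omega) (by omega)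
    rcases step_inv st with ⟨s1, s2, s3⟩ | ⟨s1, s2, s3, e', s4, s5, s6, s7, s8⟩
    · refine ⟨_, _, s2, ?_, ?_⟩
      · rw [← h2]; exact out_ffc hV hm s3
      · rw [← h3]; exact out_ffd hV hm.2.2.1
    · exfalso
      rw [hDD] at s7
      rw [s7] at s3
      simp at s3
      omega

theorem headI_sort {S : Finset (ℤ × ℤ)} {q : ℤ × ℤ} (hq : q ∈ S)
    (h : ∀ p ∈ S, q.2 ≤ p.2 → p = q) : (S.sort rcOrder).headI = q := by
  have hs := S.pairwise_sort rcOrder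
  have hm : q ∈ S.sort rcOrder := by simpa using hq
  have hm2 : ∀ x ∈ S.sort rcOrder, x ∈ S := fun x hx => by simpa using hx
  generalize S.sort rcOrder = l at *
  cases l with
  | nil => simp at hm
  | cons a l =>
    show a = q
    rcases List.mem_cons.1 hm with e | e
    · exact e.symm
    · have := (List.pairwise_cons.1 hs).1 q e
      apply h a (hm2 a (by simp))
      simp only [rcOrder] at this
      omega

theorem open_iff {n : ℕ} {D : ℕ → Finset ℕ} {s c : ℕ} (hs : s < n) :
    OpenSpace n (ofD n D) ((n : ℤ) - (c : ℤ)) ((s + 1 : ℕ) : ℤ) ↔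
      c ∉ D (s + 1) ∧ lv D s c ≤ 0 ∧ 0 < hh ((s + 1 : ℕ) : ℤ) (lv D s) (D (s + 1)) c := by
  unfold OpenSpace
  rw [labF hs, labT' hs, mem_ofD]
  constructor
  · rintro ⟨_, h1, h2⟩
    exact ⟨fun hc => h1 ⟨by omega, by omega, hc⟩, h2⟩
  · rintro ⟨h1, h2⟩
    exact ⟨by omega, fun hc => h1 hc.2.2, h2⟩

theorem bump_loop {n : ℕ} {D E E' : ℕ → Finset ℕ} (hG : GoodD n D) {s c e : ℕ} (hs : s < n)
    (hc : c ∉ D (s + 1)) (hd : c + 1 ∈ D (s + 1)) (ha : 0 < lv D s c) (hb : lv D s (c + 1) ≤ 0)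
    (hE : lv E s = app (.mv c (c + 1)) (lv D s)) (hDE : ∀ r, s < r → E r = D r)
    (he : e ≤ c) (h1 : 0 < outR ((s + 1 : ℕ) : ℤ) (lv D s) (D (s + 1)) e)
    (h2 : ∀ x, e < x → x ≤ c → outR ((s + 1 : ℕ) : ℤ) (lv D s) (D (s + 1)) x ≤ 0)
    (hE1 : E' (s + 1) = insert e ((D (s + 1)).erase (c + 1)))
    (hE2 : ∀ r, r ≠ s + 1 → E' r = E r)
    (p : ℤ × ℤ) (hp : p.2 ≤ s) (hpt : lab n (ofD n E) true p.1 p.2 = lv D s c)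
    (hpf : lab n (ofD n E) false p.1 p.2 = lv D s (c + 1)) (fuel : ℕ) :
    insertSteps n (fuel + 1) (ofD n E) p = (ofD n E, p) ::
      insertSteps n fuel (ofD n E') ((n : ℤ) - (e : ℤ), ((s + 1 : ℕ) : ℤ)) := by
  have hs1 := hDE (s + 1) (by omega)
  obtain ⟨q, hqdef⟩ : ∃ q : ℤ × ℤ, q = ((n : ℤ) - ((c + 1 : ℕ) : ℤ), ((s + 1 : ℕ) : ℤ)) := ⟨_, rfl⟩
  have hq : q ∈ ofD n E := by
    rw [hqdef, mem_ofD, hs1]; exact ⟨by omega, by omega, hd⟩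
  have hqf : lab n (ofD n E) false q.1 q.2 = lv D s c := by
    rw [hqdef]; simp only
    rw [labF hs, hE]; simp [app]
  have hqt : lab n (ofD n E) true q.1 q.2 = lv D s (c + 1) := by
    rw [hqdef]; simp only
    rw [labT' hs, hs1, hh_out hc, hE]; simp [app]
  have hnRC : ¬ IsRC n (ofD n E) := by
    rw [A2 (rng_ofD n E)]
    intro h
    have := h q hq
    rw [hqf, hqt] at this
    omega
  rw [insertSteps, if_neg hnRC]
  simp only [hpt, hpf]
  have hhead : (((ofD n E).filter fun q' => q' ≠ p ∧
      ((lab n (ofD n E) true q'.1 q'.2 = lv D s c ∧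
        lab n (ofD n E) false q'.1 q'.2 = lv D s (c + 1)) ∨
       (lab n (ofD n E) true q'.1 q'.2 = lv D s (c + 1) ∧
        lab n (ofD n E) false q'.1 q'.2 = lv D s c))).sort rcOrder).headI = q := by
    apply headI_sort
    · rw [Finset.mem_filter]
      refine ⟨hq, ?_, Or.inr ⟨hqt, hqf⟩⟩
      intro hqp
      rw [← hqp, hqdef] at hp
      simp only at hp
      omega
    · intro q' hq' hle
      rw [Finset.mem_filter] at hq'
      obtain ⟨m1, _, m2⟩ := hq'
      obtain ⟨r, c', r1, r2, r3, rfl⟩ := mem_ofD'.1 m1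
      obtain ⟨r, rfl⟩ : ∃ t, r = t + 1 := ⟨r - 1, by omega⟩
      simp only [hqdef] at hle
      simp only at m2
      rw [labF (by omega), labT' (by omega)] at m2
      obtain ⟨rfl, rfl⟩ := find_q hG hs hc hd ha hb hE hDE (by omega) (by omega) r3 m2
      exact hqdef.symm
  rw [hhead]
  let F : ℕ → Finset ℕ := fun r => if r = s + 1 then (D (s + 1)).erase (c + 1) else E r
  have hF1 : F (s + 1) = (D (s + 1)).erase (c + 1) := by simp [F]
  have hF2 : ∀ r, r ≠ s + 1 → F r = E r := fun r hr => by simp [F, hr]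
  have hFe : (ofD n E).erase q = ofD n F := by
    ext x
    rw [Finset.mem_erase, mem_ofD', mem_ofD']
    constructor
    · rintro ⟨hx, r, d, r1, r2, r3, rfl⟩
      refine ⟨r, d, r1, r2, ?_, rfl⟩
      by_cases hr : r = s + 1
      · subst hr
        rw [hF1, Finset.mem_erase, ← hs1]
        refine ⟨?_, r3⟩
        rintro rfl
        exact hx hqdef.symm
      · rwa [hF2 r hr]
    · rintro ⟨r, d, r1, r2, r3, rfl⟩
      by_cases hr : r = s + 1
      · subst hr
        rw [hF1, Finset.mem_erase, ← hs1] at r3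
        refine ⟨?_, _, d, r1, r2, r3.2, rfl⟩
        rw [hqdef, Ne, Prod.mk.injEq]
        omega
      · rw [hF2 r hr] at r3
        refine ⟨?_, r, d, r1, r2, r3, rfl⟩
        rw [hqdef, Ne, Prod.mk.injEq]
        omega
  rw [hFe]
  obtain ⟨s1, s2, s3, s4⟩ := open_struct (hG s hs) hc he h1 h2
  have hlvF : lv F s = lv E s := lv_congr (fun r _ hr => hF2 r (by omega))
  have hhF : ∀ x ≤ c, hh ((s + 1 : ℕ) : ℤ) (lv F s) (F (s + 1)) x =
      hh ((s + 1 : ℕ) : ℤ) (lv D s) (D (s + 1)) x := by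
    apply hh_congr
    · intro x hx
      rw [hlvF, hE]
      simp only [app]
      rw [if_neg (by omega), if_neg (by omega)]
    · intro x hx
      rw [hF1, Finset.mem_erase]
      exact ⟨fun h => h.2, fun h => ⟨by omega, h⟩⟩
  have hinf : sInf {x : ℤ | q.1 < x ∧ OpenSpace n (ofD n F) x q.2} = (n : ℤ) - (e : ℤ) := by
    apply IsLeast.csInf_eq
    constructor
    · refine ⟨by rw [hqdef]; simp only; push_cast; omega, ?_⟩
      rw [hqdef]
      simp only
      rw [open_iff hs, hhF e he, hF1, hlvF, hE]
      refine ⟨fun hh => s1 (Finset.mem_of_mem_erase hh), ?_, s2⟩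
      simp only [app]
      split_ifs with g1 g2
      · exact hb
      · omega
      · exact s4 e le_rfl (by omega)
    · rintro x ⟨x1, x2⟩
      have hxn : x ≤ n := x2.1
      obtain ⟨y, rfl⟩ : ∃ y : ℕ, x = (n : ℤ) - (y : ℤ) := ⟨((n : ℤ) - x).toNat, by omega⟩
      rw [hqdef] at x1 x2
      simp only at x1 x2
      rw [open_iff hs] at x2
      have hyc : y ≤ c := by push_cast at x1; omega
      rw [hhF y hyc] at x2
      by_contra hcon
      have := (s3 y (by omega) hyc).2
      omega
  rw [hinf]
  have hins : insert ((n : ℤ) - (e : ℤ), q.2) (ofD n F) = ofD n E' := by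
    ext x
    rw [Finset.mem_insert, mem_ofD', mem_ofD', hqdef]
    constructor
    · rintro (rfl | ⟨r, d, r1, r2, r3, rfl⟩)
      · exact ⟨s + 1, e, by omega, by omega, by rw [hE1]; simp, rfl⟩
      · refine ⟨r, d, r1, r2, ?_, rfl⟩
        by_cases hr : r = s + 1
        · subst hr
          rw [hF1] at r3
          rw [hE1]; exact Finset.mem_insert_of_mem r3
        · rw [hF2 r hr] at r3
          rwa [hE2 r hr]
    · rintro ⟨r, d, r1, r2, r3, rfl⟩
      by_cases hr : r = s + 1
      · subst hr
        rw [hE1, Finset.mem_insert] at r3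
        rcases r3 with rfl | r3
        · left; rfl
        · right; exact ⟨_, d, r1, r2, by rwa [hF1], rfl⟩
      · right
        rw [hE2 r hr] at r3
        exact ⟨r, d, r1, r2, by rwa [hF2 r hr], rfl⟩
  rw [hins, hqdef]

theorem ins_ne (n : ℤ) (fuel : ℕ) (R : Finset (ℤ × ℤ)) (p : ℤ × ℤ) :
    insertSteps n (fuel + 1) R p ≠ [] := by
  rw [insertSteps]; simp

theorem loop_main {n k : ℕ} {D D' : ℕ → Finset ℕ} {M : ℕ → Mv} (hG : GoodD n D)
    (h : InsAb n k D D' M) : ∀ fuel t e, k ≤ t + 1 → t < n → n - t ≤ fuel →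
    M (t + 1) = .mv e (e + 1) → e ∈ D' (t + 1) → e + 1 ∉ D' (t + 1) →
    ∃ q, (insertSteps n fuel (ofD n (mix (t + 1) D D'))
      ((n : ℤ) - (e : ℤ), ((t + 1 : ℕ) : ℤ))).getLast? = some (ofD n D', q) := by
  intro fuel
  induction fuel with
  | zero => intros; omega
  | succ fuel ih =>
  intro t e hk ht hf hM he he'
  by_cases hex : ∃ r, t + 1 ≤ r ∧ r < n ∧ D' (r + 1) ≠ D (r + 1)
  · obtain ⟨g1, g2, g3⟩ := Nat.find_spec hex
    have gmin : ∀ r, t + 1 ≤ r → r < Nat.find hex → D' (r + 1) = D (r + 1) := by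
      intro r r1 r2
      by_contra hc
      exact Nat.find_min hex r2 ⟨r1, by omega, hc⟩
    generalize Nat.find hex = s at *
    obtain ⟨j, hj⟩ := Nat.exists_eq_add_of_le g1
    obtain ⟨c, d, k1, k2, k3⟩ := keep_chain hG h hk hM j (by omega) (fun r a b => gmin r a (by omega))
    rw [← hj] at k1 k2 k3
    have st := h.step s g2
    rw [inp, if_neg (by omega), k1] at st
    rcases step_inv st with ⟨s1, s2, s3⟩ | ⟨s1, s2, s3, e', s4, s5, s6, s7, s8⟩
    · exact absurd s1 g3
    · subst s1
      have hm := ab_main hG h s g2.le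
      rw [k1] at hm
      obtain ⟨m1, m2, m3⟩ := hm
      have hmixeq : ofD n (mix (t + 1) D D') = ofD n (mix s D D') := by
        apply ofD_congr
        intro r r1 r2
        unfold mix
        split_ifs with a1 a2 a2
        · rfl
        · omega
        · obtain ⟨r, rfl⟩ : ∃ u, r = u + 1 := ⟨r - 1, by omega⟩
          exact (gmin r (by omega) (by omega)).symm
        · rfl
      have hlvmix : ∀ r, r ≤ s → lv (mix s D D') r = lv D' r := fun r hr =>
        lv_congr (fun u _ hu => by simp [mix, show u ≤ s by omega])
      have hm' := (ab_main hG h (t + 1) (by omega)).1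
      rw [hM] at hm'
      have hout : lv D' (t + 1) = outR ((t + 1 : ℕ) : ℤ) (lv D' t) (D' (t + 1)) := rfl
      have hmt : mix s D D' (t + 1) = D' (t + 1) := by simp [mix, g1]
      have hpf : lab n (ofD n (mix s D D')) false ((n : ℤ) - (e : ℤ)) ((t + 1 : ℕ) : ℤ) =
          lv D s (c + 1) := by
        rw [labF ht, hlvmix t (by omega), k3]
        have := congrFun hm' e
        rw [hout, out_in he] at this
        rw [this]; simp [app]
      have hpt : lab n (ofD n (mix s D D')) true ((n : ℤ) - (e : ℤ)) ((t + 1 : ℕ) : ℤ) =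
          lv D s c := by
        rw [labT' ht, hlvmix t (by omega), k2, hmt]
        have := congrFun hm' (e + 1)
        rw [hout, out_out he', hh_in he] at this
        rw [this]; simp [app]
      rw [hmixeq, bump_loop (E' := mix (s + 1) D D') hG g2 s2 s3 m2.2.1 m2.2.2.1
        (by rw [hlvmix s le_rfl, m1]) (fun r hr => by simp [mix, not_le.2 hr]) s4 s5 s6
        (by simp only [mix, le_refl, if_true]; exact s7)
        (fun r hr => by
          unfold mix
          split_ifs <;> first | rfl | omega)
        _ (by simp only; omega) hpt hpf]
      have hrec := ih s e' (by omega) g2 (by omega) s8 (by rw [s7]; simp) (by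
        rw [s7, Finset.mem_insert, Finset.mem_erase]
        rintro (hc | ⟨hc1, hc2⟩)
        · omega
        · have := (open_struct (hG s g2) s2 s4 s5 s6).2.2.1 (e' + 1) (by omega) (by omega)
          exact this.1 hc2)
      obtain ⟨q, hq⟩ := hrec
      refine ⟨q, ?_⟩
      rw [List.getLast?_cons, hq]; rfl
  · have heq : ofD n (mix (t + 1) D D') = ofD n D' := by
      apply ofD_congr
      intro r r1 r2
      unfold mix
      split_ifs with a1
      · rfl
      · obtain ⟨r, rfl⟩ : ∃ u, r = u + 1 := ⟨r - 1, by omega⟩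
        by_contra hc
        exact hex ⟨r, by omega, by omega, fun e => hc e.symm⟩
    rw [heq, insertSteps, if_pos (rc_of_good (ab_good hG h))]
    exact ⟨_, rfl⟩

theorem insertOne_eq {n k : ℕ} {D D' : ℕ → Finset ℕ} {M : ℕ → Mv} (hG : GoodD n D)
    (h : InsAb n k D D' M) (hk1 : 1 ≤ k) (hkn : k ≤ n) :
    insertOne n (ofD n D) (k : ℤ) = ofD n D' := by
  obtain ⟨t, rfl⟩ : ∃ t, k = t + 1 := ⟨k - 1, by omega⟩
  have ht : t < n := by omega
  have st := h.step t ht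
  rw [inp, if_pos rfl] at st
  obtain ⟨e, h1, h2, h3, h4⟩ := emp_inv st
  obtain ⟨s1, s2, s3, s4⟩ := emp_struct (hG t ht) h1 h2
  have hD : ∀ r, 1 ≤ r → r ≤ t → D' r = D r := by
    intro r r1 r2
    obtain ⟨r, rfl⟩ : ∃ u, r = u + 1 := ⟨r - 1, by omega⟩
    have st := h.step r (by omega)
    rw [inp, if_neg (by omega), ab_nil h r (by omega) (by omega)] at st
    exact nil_inv st
  have hinf : sInf {x : ℤ | OpenSpace n (ofD n D) x ((t + 1 : ℕ) : ℤ)} = (n : ℤ) - (e : ℤ) := by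
    apply IsLeast.csInf_eq
    constructor
    · exact (open_iff ht).2 ⟨s1, s4 e le_rfl, s2⟩
    · intro x hx
      have hxn : x ≤ n := hx.1
      obtain ⟨y, rfl⟩ : ∃ y : ℕ, x = (n : ℤ) - (y : ℤ) := ⟨((n : ℤ) - x).toNat, by omega⟩
      have hx2 := (open_iff ht).1 hx
      by_contra hcon
      have := (s3 y (by omega)).2
      omega
  have hins : insert ((n : ℤ) - (e : ℤ), ((t + 1 : ℕ) : ℤ)) (ofD n D) =
      ofD n (mix (t + 1) D D') := by
    ext x
    rw [Finset.mem_insert, mem_ofD', mem_ofD']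
    constructor
    · rintro (rfl | ⟨r, d, r1, r2, r3, rfl⟩)
      · exact ⟨t + 1, e, by omega, by omega, by simp [mix, h3], rfl⟩
      · refine ⟨r, d, r1, r2, ?_, rfl⟩
        unfold mix
        split_ifs with hr
        · by_cases hr2 : r = t + 1
          · subst hr2; rw [h3]; exact Finset.mem_insert_of_mem r3
          · rwa [hD r r1 (by omega)]
        · exact r3
    · rintro ⟨r, d, r1, r2, r3, rfl⟩
      unfold mix at r3
      split_ifs at r3 with hr
      · by_cases hr2 : r = t + 1
        · subst hr2
          rw [h3, Finset.mem_insert] at r3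
          rcases r3 with rfl | r3
          · left; rfl
          · right; exact ⟨_, d, r1, r2, r3, rfl⟩
        · right
          rw [hD r r1 (by omega)] at r3
          exact ⟨r, d, r1, r2, r3, rfl⟩
      · right; exact ⟨r, d, r1, r2, r3, rfl⟩
  obtain ⟨q, hq⟩ := loop_main hG h (((n : ℤ) + 1 - ((t + 1 : ℕ) : ℤ)).toNat + 1) t e le_rfl ht
    (by omega) h4 (by rw [h3]; simp) (by
      rw [h3, Finset.mem_insert]
      rintro (hc | hc)
      · omega
      · exact (s3 (e + 1) (by omega)).1 hc)
  unfold insertOne insertStepsOf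
  simp only [hinf, hins, hq]
  rfl

def okR (n : ℕ) (R : Finset (ℤ × ℤ)) : Prop := ∃ D, R = ofD n D ∧ GoodD n D

def okW (n : ℕ) (w : List ℕ) : Prop := ∀ a ∈ w, 1 ≤ a ∧ a ≤ n

theorem ok_one {n k : ℕ} {R : Finset (ℤ × ℤ)} (hR : okR n R) (h1 : 1 ≤ k) (h2 : k ≤ n) :
    okR n (insertOne n R (k : ℤ)) := by
  obtain ⟨D, rfl, hG⟩ := hR
  have h := ab_exists k hG
  exact ⟨_, insertOne_eq hG h h1 h2, ab_good hG h⟩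

theorem ok_word {n : ℕ} {R : Finset (ℤ × ℤ)} (hR : okR n R) {w : List ℕ} (hw : okW n w) :
    okR n (insertWord n R w) := by
  induction w generalizing R with
  | nil => exact hR
  | cons a w ih =>
    have ha := hw a (by simp)
    exact ih (ok_one hR ha.1 ha.2) (fun b hb => hw b (by simp [hb]))

theorem word_append (n : ℤ) (R : Finset (ℤ × ℤ)) (u v : List ℕ) :
    insertWord n R (u ++ v) = insertWord n (insertWord n R u) v := by
  simp [insertWord, List.foldl_append]

theorem knuth_i {n x y z : ℕ} {R : Finset (ℤ × ℤ)} (hR : okR n R) (hx : 1 ≤ x ∧ x ≤ n)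
    (hy : 1 ≤ y ∧ y ≤ n) (hz : 1 ≤ z ∧ z ≤ n) (hxy : x < y) (hyz : y ≤ z) :
    insertWord n R [y, x, z] = insertWord n R [y, z, x] := by
  obtain ⟨D, rfl, hG⟩ := hR
  show insertOne n (insertOne n (insertOne n (ofD n D) (y : ℤ)) (x : ℤ)) (z : ℤ) =
    insertOne n (insertOne n (insertOne n (ofD n D) (y : ℤ)) (z : ℤ)) (x : ℤ)
  have h1 := ab_exists y hG
  have g1 := ab_good hG h1
  have h2 := ab_exists z g1
  have g2 := ab_good g1 h2
  have h3 := ab_exists x g2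
  have k2 := ab_exists x g1
  have f2 := ab_good g1 k2
  have k3 := ab_exists z f2
  rw [insertOne_eq hG h1 hy.1 hy.2, insertOne_eq g1 h2 hz.1 hz.2, insertOne_eq g2 h3 hx.1 hx.2,
    insertOne_eq g1 k2 hx.1 hx.2, insertOne_eq f2 k3 hz.1 hz.2]
  apply ofD_congr
  intro s s1 s2
  obtain ⟨s, rfl⟩ : ∃ u, s = u + 1 := ⟨s - 1, by omega⟩
  exact (ab_knuth_i hx.1 hxy hyz hG h1 h2 h3 h1 k2 k3 s (by omega)).symm

theorem knuth_ii {n x y z : ℕ} {R : Finset (ℤ × ℤ)} (hR : okR n R) (hx : 1 ≤ x ∧ x ≤ n)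
    (hy : 1 ≤ y ∧ y ≤ n) (hz : 1 ≤ z ∧ z ≤ n) (hxy : x ≤ y) (hyz : y < z) :
    insertWord n R [x, z, y] = insertWord n R [z, x, y] := by
  obtain ⟨D, rfl, hG⟩ := hR
  show insertOne n (insertOne n (insertOne n (ofD n D) (x : ℤ)) (z : ℤ)) (y : ℤ) =
    insertOne n (insertOne n (insertOne n (ofD n D) (z : ℤ)) (x : ℤ)) (y : ℤ)
  have h1 := ab_exists x hG
  have g1 := ab_good hG h1
  have h2 := ab_exists z g1
  have g2 := ab_good g1 h2
  have h3 := ab_exists y g2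
  have k1 := ab_exists z hG
  have f1 := ab_good hG k1
  have k2 := ab_exists x f1
  have f2 := ab_good f1 k2
  have k3 := ab_exists y f2
  rw [insertOne_eq hG h1 hx.1 hx.2, insertOne_eq g1 h2 hz.1 hz.2, insertOne_eq g2 h3 hy.1 hy.2,
    insertOne_eq hG k1 hz.1 hz.2, insertOne_eq f1 k2 hx.1 hx.2, insertOne_eq f2 k3 hy.1 hy.2]
  apply ofD_congr
  intro s s1 s2
  obtain ⟨s, rfl⟩ : ∃ u, s = u + 1 := ⟨s - 1, by omega⟩
  exact ab_knuth_ii hx.1 hxy hyz hG h1 h2 h3 k1 k2 k3 s (by omega)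

theorem knuth_three {n : ℕ} {R : Finset (ℤ × ℤ)} (hR : okR n R) {u v : List ℕ} {a b c a' b' c' : ℕ}
    (hu : okW n u) (h : ∀ R, okR n R → insertWord n R [a, b, c] = insertWord n R [a', b', c']) :
    insertWord n R (u ++ a :: b :: c :: v) = insertWord n R (u ++ a' :: b' :: c' :: v) := by
  rw [show a :: b :: c :: v = [a, b, c] ++ v from rfl,
    show a' :: b' :: c' :: v = [a', b', c'] ++ v from rfl, word_append, word_append, word_append,
    word_append, h _ (ok_word hR hu)]

theorem knuth_move {n : ℕ} {w₁ w₂ : List ℕ} (h : KnuthMove w₁ w₂) :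
    (okW n w₁ ↔ okW n w₂) ∧ (okW n w₁ → ∀ R, okR n R → insertWord n R w₁ = insertWord n R w₂) := by
  rcases h with ⟨u, v, x, y, z, h1, h2, rfl, rfl⟩ | ⟨u, v, x, y, z, h1, h2, rfl, rfl⟩
  · constructor
    · simp only [okW, List.mem_append, List.mem_cons]
      constructor <;> intro h a ha <;> exact h a (by tauto)
    · intro hw R hR
      exact knuth_three hR (fun a ha => hw a (by simp [ha])) fun R hR =>
        knuth_i hR (hw x (by simp)) (hw y (by simp)) (hw z (by simp)) h1 h2
  · constructor
    · simp only [okW, List.mem_append, List.mem_cons]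
      constructor <;> intro h a ha <;> exact h a (by tauto)
    · intro hw R hR
      exact knuth_three hR (fun a ha => hw a (by simp [ha])) fun R hR =>
        knuth_ii hR (hw x (by simp)) (hw y (by simp)) (hw z (by simp)) h1 h2

theorem knuth_equiv {n : ℕ} {w₁ w₂ : List ℕ} (h : KnuthEquiv w₁ w₂) :
    (okW n w₁ ↔ okW n w₂) ∧ (okW n w₁ → ∀ R, okR n R → insertWord n R w₁ = insertWord n R w₂) := by
  induction h with
  | rel _ _ h => exact knuth_move h
  | refl _ => exact ⟨Iff.rfl, fun _ _ _ => rfl⟩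
  | symm _ _ _ ih => exact ⟨ih.1.symm, fun hw R hR => (ih.2 (ih.1.2 hw) R hR).symm⟩
  | trans _ _ _ _ _ i1 i2 =>
    exact ⟨i1.1.trans i2.1, fun hw R hR => (i1.2 hw R hR).trans (i2.2 (i1.1.1 hw) R hR)⟩

theorem ok_reading (n : ℕ) (μ : ℕ → ℕ) (Y : SSYT n μ) : okW n (readingWord n μ Y) := by
  intro a ha
  simp only [readingWord, List.mem_flatMap, List.mem_map, List.mem_reverse, List.mem_range] at ha
  obtain ⟨j, ⟨i, hi, rfl⟩, c, hc, rfl⟩ := ha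
  exact Y.entry_mem _ _ (by omega) (by omega) hc

/-- If `Y` is the (unique) semistandard Young tableau whose reading
word is Knuth equivalent to the concatenation `v(Y₁)v(Y₂)` (i.e. `Y = Y₁ ← Y₂`), then
`(R ← Y₁) ← Y₂ = R ← Y` for any rc-graph `R` satisfying (*). -/
theorem insert_tableau_assoc (n : ℕ) (hn : 0 < n) (R : Finset (ℤ × ℤ))
    (hR : IsRC n R) (hS : Star n R) (μ₁ μ₂ μ : ℕ → ℕ)
    (Y₁ : SSYT n μ₁) (Y₂ : SSYT n μ₂) (Y : SSYT n μ)
    (hμ₁ : IsPartition n μ₁) (hμ₂ : IsPartition n μ₂) (hμ : IsPartition n μ)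
    (hK : KnuthEquiv (readingWord n μ Y) (readingWord n μ₁ Y₁ ++ readingWord n μ₂ Y₂)) :
    insertWord n (insertWord n R (readingWord n μ₁ Y₁)) (readingWord n μ₂ Y₂)
      = insertWord n R (readingWord n μ Y) := by
  rw [← word_append]
  exact ((knuth_equiv hK).2 (ok_reading n μ Y) R (good_of_star hR hS)).symm

end RCGraphs
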